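/- arXiv:math/0606720 — 2 statements merged into one kernel-verified Lean document; each statement's English description precedes it below -/
import Mathlib

section
/- Let (R, m) be a complete Noetherian local ring, M a finite R-module of Krull dimension n ≥ 1, and a an ideal of R. If H^n_a(M) ≠ 0, then there exists an ideal b of R with dim(R/b) ≤ 1 such that H^n_a(M) is isomorphic to H^n_b(M) as an R-module. -/
/-!
STATEMENT 3 (Dibaei–Jafari, Corollary 2.2): if `H^n_a(M) ≠ 0` then there is an ideal `b`
with `dim(R/b) ≤ 1` and `H^n_a(M) ≅ H^n_b(M)`.
-/

open CategoryTheory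

noncomputable section

universe u

/-- A prime ideal `p` is an *attached prime* of the `R`-module `N` if `p` is the annihilator
of some quotient of `N`. -/
def attachedPrimes (R : Type u) [CommRing R] (N : Type u) [AddCommGroup N] [Module R N] :
    Set (Ideal R) :=
  { p | p.IsPrime ∧ ∃ K : Submodule R N, p = Module.annihilator R (N ⧸ K) }

/-- `Assh_R(M)`: the associated primes `p` of `M` with `dim (R ⧸ p) = dim M`, where the
dimension of `M` is recorded by the natural number `n`. -/
def assh (R : Type u) [CommRing R] (M : Type u) [AddCommGroup M] [Module R M] (n : ℕ) :
    Set (Ideal R) :=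
  { p ∈ associatedPrimes R M | ringKrullDim (R ⧸ p) = (n : WithBot (WithTop ℕ)) }

namespace LCHelp
section LD
open Limits
variable {C D : Type*} [Category C] [Category D] [Abelian C] [Abelian D] [EnoughProjectives C]

def KH (F : C ⥤ D) [F.Additive] (X : C) (n : ℕ) : D :=
  ((F.mapHomologicalComplex (ComplexShape.down ℕ)).obj (projectiveResolution X).complex).homology n

def KHiso (F : C ⥤ D) [F.Additive] (X : C) (n : ℕ) : (F.leftDerived n).obj X ≅ KH F X n :=
  (projectiveResolution X).isoLeftDerivedObj F n

def KHmap (F : C ⥤ D) [F.Additive] {X Y : C} (f : X ⟶ Y) (n : ℕ) : KH F X n ⟶ KH F Y n :=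
  HomologicalComplex.homologyMap
    ((F.mapHomologicalComplex (ComplexShape.down ℕ)).map (ProjectiveResolution.lift f _ _)) n

def KHnat {F G : C ⥤ D} [F.Additive] [G.Additive] (α : F ⟶ G) (X : C) (n : ℕ) :
    KH F X n ⟶ KH G X n :=
  HomologicalComplex.homologyMap ((NatTrans.mapHomologicalComplex α (ComplexShape.down ℕ)).app
      (projectiveResolution X).complex) n

lemma lift0 {X Y : C} (f : X ⟶ Y) (P : ProjectiveResolution X) (Q : ProjectiveResolution Y) :
    (ProjectiveResolution.lift f P Q).f 0 ≫ Q.π.f 0 = P.π.f 0 ≫ f := by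
  have := HomologicalComplex.congr_hom (ProjectiveResolution.lift_commutes f P Q) 0
  rw [HomologicalComplex.comp_f, HomologicalComplex.comp_f, ChainComplex.single₀_map_f_zero] at this
  exact this

lemma KHiso_hom (F : C ⥤ D) [F.Additive] {X Y : C} (f : X ⟶ Y) (n : ℕ) :
    (F.leftDerived n).map f ≫ (KHiso F Y n).hom = (KHiso F X n).hom ≫ KHmap F f n :=
  ProjectiveResolution.isoLeftDerivedObj_hom_naturality f
      (projectiveResolution X) (projectiveResolution Y)
      (ProjectiveResolution.lift f _ _) (lift0 _ _ _) F n

lemma KHiso_inv (F : C ⥤ D) [F.Additive] {X Y : C} (f : X ⟶ Y) (n : ℕ) :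
    (KHiso F X n).inv ≫ (F.leftDerived n).map f = KHmap F f n ≫ (KHiso F Y n).inv := by
  rw [← cancel_mono (KHiso F Y n).hom, Category.assoc, Category.assoc, KHiso_hom,
    Iso.inv_hom_id_assoc, Iso.inv_hom_id, Category.comp_id]

lemma KH_nat {F G : C ⥤ D} [F.Additive] [G.Additive] (α : F ⟶ G) (X : C) (n : ℕ) :
    (NatTrans.leftDerived α n).app X = (KHiso F X n).hom ≫ KHnat α X n ≫ (KHiso G X n).inv :=
  (projectiveResolution X).leftDerived_app_eq α n

variable {F₁ F₂ F₃ : C ⥤ D} [F₁.Additive] [F₂.Additive] [F₃.Additive]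
  (α : F₁ ⟶ F₂) (β : F₂ ⟶ F₃) (w : α ≫ β = 0)

def sc (w : α ≫ β = 0) (X : C) : ShortComplex (ChainComplex D ℕ) :=
  ShortComplex.mk ((NatTrans.mapHomologicalComplex α (ComplexShape.down ℕ)).app
      (projectiveResolution X).complex)
    ((NatTrans.mapHomologicalComplex β (ComplexShape.down ℕ)).app
      (projectiveResolution X).complex) (by
      ext i
      exact congr_app w ((projectiveResolution X).complex.X i))

def scMap (w : α ≫ β = 0) {X Y : C} (f : X ⟶ Y) : sc α β w X ⟶ sc α β w Y where
  τ₁ := (F₁.mapHomologicalComplex _).map (ProjectiveResolution.lift f _ _)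
  τ₂ := (F₂.mapHomologicalComplex _).map (ProjectiveResolution.lift f _ _)
  τ₃ := (F₃.mapHomologicalComplex _).map (ProjectiveResolution.lift f _ _)
  comm₁₂ := (NatTrans.mapHomologicalComplex α (ComplexShape.down ℕ)).naturality _
  comm₂₃ := (NatTrans.mapHomologicalComplex β (ComplexShape.down ℕ)).naturality _

def SEP (w : α ≫ β = 0) : Prop := ∀ P : C, Projective P → (ShortComplex.mk (α.app P) (β.app P)
  (congr_app w P)).ShortExact

variable {α β w}

lemma sc_shortExact (h : SEP α β w) (X : C) : (sc α β w X).ShortExact := by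
  apply HomologicalComplex.shortExact_of_degreewise_shortExact
  intro i
  exact h ((projectiveResolution X).complex.X i) inferInstance

def dl (h : SEP α β w) (X : C) (n : ℕ) : KH F₃ X (n+1) ⟶ KH F₁ X n :=
  (sc_shortExact h X).δ (n+1) n rfl

lemma dl_nat (h : SEP α β w) {X Y : C} (f : X ⟶ Y) (n : ℕ) :
    dl h X n ≫ KHmap F₁ f n = KHmap F₃ f (n+1) ≫ dl h Y n :=
  HomologicalComplex.HomologySequence.δ_naturality (scMap α β w f)
      (sc_shortExact h X) (sc_shortExact h Y) (n+1) n rfl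

def δ (h : SEP α β w) (n : ℕ) : F₃.leftDerived (n+1) ⟶ F₁.leftDerived n where
  app X := (KHiso F₃ X (n+1)).hom ≫ dl h X n ≫ (KHiso F₁ X n).inv
  naturality X Y f := by
    rw [reassoc_of% (KHiso_hom F₃ f), Category.assoc, Category.assoc, KHiso_inv,
      reassoc_of% (dl_nat h f)]

lemma KH_zero (w : α ≫ β = 0) (n : ℕ) (X : C) : KHnat α X n ≫ KHnat β X n = 0 := by
  have : (NatTrans.mapHomologicalComplex α (ComplexShape.down ℕ)).app
      (projectiveResolution X).complex ≫ (NatTrans.mapHomologicalComplex β (ComplexShape.down ℕ)).app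
      (projectiveResolution X).complex = 0 := (sc α β w X).zero
  refine (HomologicalComplex.homologyMap_comp _ _ n).symm.trans ?_
  rw [this, HomologicalComplex.homologyMap_zero]
  rfl

lemma KH_zero2 (h : SEP α β w) (n : ℕ) (X : C) : KHnat β X (n+1) ≫ dl h X n = 0 :=
  ((sc_shortExact h X).comp_δ (n+1) n rfl)

lemma KH_zero3 (h : SEP α β w) (n : ℕ) (X : C) : dl h X n ≫ KHnat α X n = 0 :=
  ((sc_shortExact h X).δ_comp (n+1) n rfl)

lemma comp_zero1 (w : α ≫ β = 0) (n : ℕ) (X : C) : (NatTrans.leftDerived α n).app X ≫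
    (NatTrans.leftDerived β n).app X = 0 := by
  rw [KH_nat, KH_nat]
  simp only [Category.assoc, Iso.inv_hom_id_assoc, reassoc_of% (KH_zero w n X), zero_comp,
    comp_zero]

lemma exact2 (h : SEP α β w) (n : ℕ) (X : C) :
    (ShortComplex.mk ((NatTrans.leftDerived α n).app X)
    ((NatTrans.leftDerived β n).app X) (comp_zero1 w n X)).Exact := by
  have e : (ShortComplex.mk (KHnat α X n) (KHnat β X n) (KH_zero w n X)).Exact :=
    (sc_shortExact h X).homology_exact₂ n
  refine ShortComplex.exact_of_iso (ShortComplex.isoMk (KHiso F₁ X n).symm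
    (KHiso F₂ X n).symm (KHiso F₃ X n).symm ?_ ?_) e <;> simp [KH_nat]

lemma comp_zero2 (h : SEP α β w) (n : ℕ) (X : C) :
    (NatTrans.leftDerived β (n+1)).app X ≫ (δ h n).app X = 0 := by
  rw [KH_nat, δ]
  simp only [Category.assoc, Iso.inv_hom_id_assoc, reassoc_of% (KH_zero2 h n X), zero_comp,
    comp_zero]

lemma exact3 (h : SEP α β w) (n : ℕ) (X : C) :
    (ShortComplex.mk ((NatTrans.leftDerived β (n+1)).app X)
    ((δ h n).app X) (comp_zero2 h n X)).Exact := by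
  have e : (ShortComplex.mk (KHnat β X (n+1)) (dl h X n) (KH_zero2 h n X)).Exact :=
    (sc_shortExact h X).homology_exact₃ (n+1) n rfl
  refine ShortComplex.exact_of_iso (ShortComplex.isoMk (KHiso F₂ X (n+1)).symm
    (KHiso F₃ X (n+1)).symm (KHiso F₁ X n).symm ?_ ?_) e <;> simp [KH_nat, δ]

lemma comp_zero3 (h : SEP α β w) (n : ℕ) (X : C) :
    (δ h n).app X ≫ (NatTrans.leftDerived α n).app X = 0 := by
  rw [KH_nat, δ]
  simp only [Category.assoc, Iso.inv_hom_id_assoc, reassoc_of% (KH_zero3 h n X), zero_comp,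
    comp_zero]

lemma exact1 (h : SEP α β w) (n : ℕ) (X : C) :
    (ShortComplex.mk ((δ h n).app X) ((NatTrans.leftDerived α n).app X)
     (comp_zero3 h n X)).Exact := by
  have e : (ShortComplex.mk (dl h X n) (KHnat α X n) (KH_zero3 h n X)).Exact :=
    (sc_shortExact h X).homology_exact₁ (n+1) n rfl
  refine ShortComplex.exact_of_iso (ShortComplex.isoMk (KHiso F₃ X (n+1)).symm
    (KHiso F₁ X n).symm (KHiso F₂ X n).symm ?_ ?_) e <;> simp [KH_nat, δ]

end LD
end LCHelp

namespace LCHelp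
section EX
open Limits Opposite
variable {R : Type u} [CommRing R]

abbrev GY (Y : ModuleCat.{u} R) : ModuleCat.{u} R ⥤ (ModuleCat.{u} R)ᵒᵖ :=
  ((linearYoneda R (ModuleCat.{u} R)).obj Y).rightOp
abbrev GM {Y Z : ModuleCat.{u} R} (f : Y ⟶ Z) : GY Z ⟶ GY Y :=
  NatTrans.rightOp ((linearYoneda R (ModuleCat.{u} R)).map f)

lemma GM_zero (S : ShortComplex (ModuleCat.{u} R)) : GM S.g ≫ GM S.f = 0 := by
  ext X
  apply Quiver.Hom.unop_inj
  ext (x : X ⟶ S.X₁)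
  change (x ≫ S.f) ≫ S.g = 0
  simp

lemma GM_SEP (S : ShortComplex (ModuleCat.{u} R)) (hS : S.ShortExact) :
    SEP (GM S.g) (GM S.f) (GM_zero S) := by
  intro P hP
  have : (ShortComplex.mk (((linearYoneda R (ModuleCat.{u} R)).map S.f).app (op P))
      (((linearYoneda R (ModuleCat.{u} R)).map S.g).app (op P)) (by
        ext (x : P ⟶ S.X₁)
        change (x ≫ S.f) ≫ S.g = 0
        simp)).ShortExact := by
    have := hS.mono_f
    have := hS.epi_g
    refine ShortComplex.ShortExact.mk' ?_ ?_ ?_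
    · rw [ShortComplex.moduleCat_exact_iff]
      intro (x : P ⟶ S.X₂) hx
      have hx : x ≫ S.g = 0 := hx
      exact ⟨hS.exact.lift x hx, hS.exact.lift_f x hx⟩
    · rw [ModuleCat.mono_iff_injective]
      intro (x : P ⟶ S.X₁) (y : P ⟶ S.X₁) hxy
      have hxy : x ≫ S.f = y ≫ S.f := hxy
      exact (cancel_mono _).1 hxy
    · rw [ModuleCat.epi_iff_surjective]
      intro (x : P ⟶ S.X₃)
      exact ⟨Projective.factorThru x S.g, Projective.factorThru_comp x S.g⟩
  exact this.op

def EE (X Y : ModuleCat.{u} R) (i : ℕ) : ModuleCat.{u} R :=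
  ((Ext R (ModuleCat.{u} R) i).obj (op X)).obj Y
def EEx {X X' : ModuleCat.{u} R} (h : X ⟶ X') (Y : ModuleCat.{u} R) (i : ℕ) : EE X' Y i ⟶ EE X Y i :=
  ((Ext R (ModuleCat.{u} R) i).map h.op).app Y
def EEy (X : ModuleCat.{u} R) {Y Y' : ModuleCat.{u} R} (h : Y ⟶ Y') (i : ℕ) : EE X Y i ⟶ EE X Y' i :=
  ((Ext R (ModuleCat.{u} R) i).obj (op X)).map h

variable {S : ShortComplex (ModuleCat.{u} R)} (hS : S.ShortExact)

def EEδ (X : ModuleCat.{u} R) (i : ℕ) : EE X S.X₃ i ⟶ EE X S.X₁ (i+1) :=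
  ((δ (GM_SEP S hS) i).app X).unop

lemma EEδ_nat {X X' : ModuleCat.{u} R} (h : X ⟶ X') (i : ℕ) :
    EEδ hS X' i ≫ EEx h S.X₁ (i+1) = EEx h S.X₃ i ≫ EEδ hS X i := by
  have := congrArg Quiver.Hom.unop ((δ (GM_SEP S hS) i).naturality h)
  exact this

lemma EE_ex2 (hS : S.ShortExact) (X : ModuleCat.{u} R) (i : ℕ) (x : EE X S.X₂ i) (hx : EEy X S.g i x = 0) :
    ∃ y, EEy X S.f i y = x :=
  (ShortComplex.moduleCat_exact_iff _).1 (exact2 (GM_SEP S hS) i X).unop x hx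

lemma EE_ex3 (X : ModuleCat.{u} R) (i : ℕ) (x : EE X S.X₃ i) (hx : EEδ hS X i x = 0) :
    ∃ y, EEy X S.g i y = x :=
  (ShortComplex.moduleCat_exact_iff _).1 (exact1 (GM_SEP S hS) i X).unop x hx

lemma EE_ex1 (X : ModuleCat.{u} R) (i : ℕ) (x : EE X S.X₁ (i+1)) (hx : EEy X S.f (i+1) x = 0) :
    ∃ y, EEδ hS X i y = x :=
  (ShortComplex.moduleCat_exact_iff _).1 (exact3 (GM_SEP S hS) i X).unop x hx

lemma EE_z2 (S : ShortComplex (ModuleCat.{u} R)) (X : ModuleCat.{u} R) (i : ℕ) : EEy X S.f i ≫ EEy X S.g i = 0 :=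
  congrArg Quiver.Hom.unop (comp_zero1 (GM_zero S) i X)

lemma EE_z3 (X : ModuleCat.{u} R) (i : ℕ) : EEy X S.g i ≫ EEδ hS X i = 0 :=
  congrArg Quiver.Hom.unop (comp_zero3 (GM_SEP S hS) i X)

lemma EE_z1 (X : ModuleCat.{u} R) (i : ℕ) : EEδ hS X i ≫ EEy X S.f (i+1) = 0 :=
  congrArg Quiver.Hom.unop (comp_zero2 (GM_SEP S hS) i X)

end EX
end LCHelp

namespace LCHelp
section CO
open Limits Opposite localCohomology
variable {R : Type u} [CommRing R] (a : Ideal R)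

def RQ (t : (ℕᵒᵖ)ᵒᵖ) : ModuleCat.{u} R := ModuleCat.of R (R ⧸ a ^ (unop (unop t)))
def RQm {t s : (ℕᵒᵖ)ᵒᵖ} (h : t ⟶ s) : RQ a s ⟶ RQ a t :=
  (ringModIdeals (idealPowersDiagram a)).map h.unop

abbrev HH (i : ℕ) (M : ModuleCat.{u} R) : ModuleCat.{u} R := (localCohomology a i).obj M

def Hι (i : ℕ) (M : ModuleCat.{u} R) (t : (ℕᵒᵖ)ᵒᵖ) : EE (RQ a t) M i ⟶ HH a i M :=
  ((colimit.ι (diagram (idealPowersDiagram a) i)) t).app M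

def Hcol (i : ℕ) (M : ModuleCat.{u} R) : 
    IsColimit (((evaluation _ _).obj M).mapCocone (colimit.cocone (diagram (idealPowersDiagram a) i))) :=
  isColimitOfPreserves ((evaluation _ _).obj M) (colimit.isColimit (diagram (idealPowersDiagram a) i))

lemma Hι_w (i : ℕ) (M : ModuleCat.{u} R) {t s : (ℕᵒᵖ)ᵒᵖ} (h : t ⟶ s) :
    EEx (RQm a h) M i ≫ Hι a i M s = Hι a i M t :=
  (((evaluation _ _).obj M).mapCocone (colimit.cocone (diagram (idealPowersDiagram a) i))).w h

lemma Hι_nat (i : ℕ) {M N : ModuleCat.{u} R} (f : M ⟶ N) (t : (ℕᵒᵖ)ᵒᵖ) :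
    EEy (RQ a t) f i ≫ Hι a i N t = Hι a i M t ≫ (localCohomology a i).map f :=
  ((colimit.ι (diagram (idealPowersDiagram a) i)) t).naturality f

lemma EE_comm {X X' : ModuleCat.{u} R} (h : X ⟶ X') {Y Y' : ModuleCat.{u} R} (f : Y ⟶ Y') (i : ℕ) :
    EEy X' f i ≫ EEx h Y' i = EEx h Y i ≫ EEy X f i :=
  ((Ext R (ModuleCat.{u} R) i).map h.op).naturality f

instance : PreservesFilteredColimitsOfSize.{0,0} (forget (ModuleCat.{u} R)) :=
  preservesFilteredColimitsOfSize_shrink.{0, u, 0, u} (forget (ModuleCat.{u} R))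

instance : PreservesColimitsOfShape ((ℕᵒᵖ)ᵒᵖ) (forget (ModuleCat.{u} R)) :=
  PreservesFilteredColimitsOfSize.preserves_filtered_colimits _

lemma H_rep (i : ℕ) (M : ModuleCat.{u} R) (x : HH a i M) : ∃ t e, Hι a i M t e = x :=
  Concrete.isColimit_exists_rep _ (Hcol a i M) x

lemma H_zero (i : ℕ) (M : ModuleCat.{u} R) (t) (e : EE (RQ a t) M i) (h : Hι a i M t e = 0) :
    ∃ s, ∃ f : t ⟶ s, EEx (RQm a f) M i e = 0 := by
  have h0 : Hι a i M t e = Hι a i M t 0 := by rw [h, map_zero]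
  obtain ⟨s, f, g, hh⟩ := Concrete.isColimit_exists_of_rep_eq 
    (diagram (idealPowersDiagram a) i ⋙ (evaluation _ _).obj M) (Hcol a i M) (x := e) (y := (0 : EE (RQ a t) M i)) h0
  refine ⟨s, f, ?_⟩
  have : EEx (RQm a f) M i e = EEx (RQm a g) M i 0 := hh
  rw [this, map_zero]

lemma H_hom_ext (i : ℕ) (M N : ModuleCat.{u} R) (f g : HH a i M ⟶ N)
    (h : ∀ t, Hι a i M t ≫ f = Hι a i M t ≫ g) : f = g :=
  (Hcol a i M).hom_ext h

def Hdesc (i : ℕ) (M N : ModuleCat.{u} R) (f : ∀ t, EE (RQ a t) M i ⟶ N)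
   (hf : ∀ t s (h : t ⟶ s), EEx (RQm a h) M i ≫ f s = f t) : HH a i M ⟶ N :=
  (Hcol a i M).desc 
    (Cocone.mk N (NatTrans.mk f (fun t s h => Eq.trans (hf t s h) (Category.comp_id _).symm)))

lemma Hdesc_ι (i : ℕ) (M N : ModuleCat.{u} R) (f : ∀ t, EE (RQ a t) M i ⟶ N)
   (hf : ∀ t s (h : t ⟶ s), EEx (RQm a h) M i ≫ f s = f t) (t) :
   Hι a i M t ≫ Hdesc a i M N f hf = f t := (Hcol a i M).fac _ t

variable {S : ShortComplex (ModuleCat.{u} R)} (hS : S.ShortExact)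

def Hδ (i : ℕ) : HH a i S.X₃ ⟶ HH a (i+1) S.X₁ :=
  Hdesc a i _ _ (fun t => EEδ hS (RQ a t) i ≫ Hι a (i+1) S.X₁ t) (fun t s h => by
    rw [← reassoc_of% EEδ_nat, Hι_w])

lemma Hι_δ (i : ℕ) (t) : Hι a i S.X₃ t ≫ Hδ a hS i = EEδ hS (RQ a t) i ≫ Hι a (i+1) S.X₁ t :=
  Hdesc_ι ..

lemma H_ex2 (hS : S.ShortExact) (i : ℕ) : Function.Exact ((localCohomology a i).map S.f) ((localCohomology a i).map S.g) := by
  intro x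
  constructor
  · intro hx
    obtain ⟨t, e, rfl⟩ := H_rep _ _ _ x
    rw [← ConcreteCategory.comp_apply, ← Hι_nat, ConcreteCategory.comp_apply] at hx
    obtain ⟨s, f, hf⟩ := H_zero _ _ _ _ _ hx
    rw [← ConcreteCategory.comp_apply, EE_comm, ConcreteCategory.comp_apply] at hf
    obtain ⟨y, hy⟩ := EE_ex2 hS _ _ _ hf
    refine ⟨Hι a i _ s y, ?_⟩
    rw [← ConcreteCategory.comp_apply, ← Hι_nat, ConcreteCategory.comp_apply, hy,
      ← ConcreteCategory.comp_apply, Hι_w]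
  · rintro ⟨y, rfl⟩
    rw [← ConcreteCategory.comp_apply, ← Functor.map_comp, S.zero]
    obtain ⟨t, e, rfl⟩ := H_rep _ _ _ y
    rw [← S.zero, Functor.map_comp, ← ConcreteCategory.comp_apply, ← Category.assoc, ← Hι_nat,
      Category.assoc, ← Hι_nat, ← Category.assoc, EE_z2, zero_comp]
    rfl

lemma H_ex3 (i : ℕ) : Function.Exact ((localCohomology a i).map S.g) (Hδ a hS i) := by
  intro x
  constructor
  · intro hx
    obtain ⟨t, e, rfl⟩ := H_rep _ _ _ x
    rw [← ConcreteCategory.comp_apply, Hι_δ, ConcreteCategory.comp_apply] at hx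
    obtain ⟨s, f, hf⟩ := H_zero _ _ _ _ _ hx
    rw [← ConcreteCategory.comp_apply, EEδ_nat, ConcreteCategory.comp_apply] at hf
    obtain ⟨y, hy⟩ := EE_ex3 hS _ _ _ hf
    refine ⟨Hι a i _ s y, ?_⟩
    rw [← ConcreteCategory.comp_apply, ← Hι_nat, ConcreteCategory.comp_apply, hy,
      ← ConcreteCategory.comp_apply, Hι_w]
  · rintro ⟨y, rfl⟩
    obtain ⟨t, e, rfl⟩ := H_rep _ _ _ y
    rw [← ConcreteCategory.comp_apply, ← ConcreteCategory.comp_apply, ← Category.assoc, ← Hι_nat,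
      Category.assoc, Hι_δ, ← Category.assoc, EE_z3, zero_comp]
    rfl

lemma H_ex1 (i : ℕ) : Function.Exact (Hδ a hS i) ((localCohomology a (i+1)).map S.f) := by
  intro x
  constructor
  · intro hx
    obtain ⟨t, e, rfl⟩ := H_rep _ _ _ x
    rw [← ConcreteCategory.comp_apply, ← Hι_nat, ConcreteCategory.comp_apply] at hx
    obtain ⟨s, f, hf⟩ := H_zero _ _ _ _ _ hx
    rw [← ConcreteCategory.comp_apply, EE_comm, ConcreteCategory.comp_apply] at hf
    obtain ⟨y, hy⟩ := EE_ex1 hS _ _ _ hf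
    refine ⟨Hι a i _ s y, ?_⟩
    rw [← ConcreteCategory.comp_apply, Hι_δ, ConcreteCategory.comp_apply, hy,
      ← ConcreteCategory.comp_apply, Hι_w]
  · rintro ⟨y, rfl⟩
    obtain ⟨t, e, rfl⟩ := H_rep _ _ _ y
    rw [← ConcreteCategory.comp_apply, ← ConcreteCategory.comp_apply, ← Category.assoc, Hι_δ,
      Category.assoc, ← Hι_nat, ← Category.assoc, EE_z1, zero_comp]
    rfl

end CO
end LCHelp

namespace LCHelp
section DD
open Limits Opposite localCohomology

lemma homologyMap_central {D : Type*} [Category D] [Abelian D] (z : 𝟭 D ⟶ 𝟭 D)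
    {K : ChainComplex D ℕ} (φ : K ⟶ K) (hφ : ∀ i, φ.f i = z.app (K.X i)) (n : ℕ) :
    HomologicalComplex.homologyMap φ n = z.app (K.homology n) := by
  have hz : ∀ {X Y : D} (f : X ⟶ Y), f ≫ z.app Y = z.app X ≫ f := fun f => z.naturality f
  have h1 : HomologicalComplex.cyclesMap φ n = z.app (K.cycles n) := by
    rw [← cancel_mono (K.iCycles n), HomologicalComplex.cyclesMap_i, hφ, hz]
  rw [← cancel_epi (K.homologyπ n), HomologicalComplex.homologyπ_naturality, h1, hz]

variable {R : Type u} [CommRing R]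

def zop (r : R) : 𝟭 ((ModuleCat.{u} R)ᵒᵖ) ⟶ 𝟭 ((ModuleCat.{u} R)ᵒᵖ) where
  app X := (r • 𝟙 X.unop).op
  naturality X Y f := by
    apply Quiver.Hom.unop_inj
    change (r • 𝟙 _) ≫ f.unop = f.unop ≫ (r • 𝟙 _)
    simp

lemma EEy_smul (X Y : ModuleCat.{u} R) (r : R) (i : ℕ) :
    EEy X (r • 𝟙 Y) i = r • 𝟙 _ := by
  have e : (NatTrans.leftDerived (GM (r • 𝟙 Y)) i).app X = (r • 𝟙 (EE X Y i)).op := by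
    have hz : KHnat (GM (r • 𝟙 Y)) X i = (zop r).app (KH (GY Y) X i) :=
      homologyMap_central (zop r) _ (fun i => by
        apply Quiver.Hom.unop_inj
        ext (x : _ ⟶ Y)
        change x ≫ (r • 𝟙 Y) = r • x
        simp) i
    have hn := (zop r).naturality (KHiso (GY Y) X i).inv
    rw [KH_nat, hz]
    have hn' : (zop r).app (KH (GY Y) X i) ≫ (KHiso (GY Y) X i).inv = 
      (KHiso (GY Y) X i).inv ≫ (zop r).app (((GY Y).leftDerived i).obj X) := hn.symm
    rw [hn', Iso.hom_inv_id_assoc]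
    rfl
  exact congrArg Quiver.Hom.unop e

lemma H_smul (a : Ideal R) (i : ℕ) (M : ModuleCat.{u} R) (r : R) :
    (localCohomology a i).map (r • 𝟙 M) = r • 𝟙 _ := by
  apply H_hom_ext
  intro t
  rw [← Hι_nat, EEy_smul]
  simp

lemma EE_inj (X I : ModuleCat.{u} R) [Injective I] (i : ℕ) : IsZero (EE X I (i+1)) := by
  have : IsZero (KH (GY I) X (i+1)) := by
    refine IsZero.of_iso ?_ (Iso.refl (HomologicalComplex.homology (((GY I).mapHomologicalComplex (ComplexShape.down ℕ)).obj (projectiveResolution X).complex) (i+1)))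
    rw [← HomologicalComplex.exactAt_iff_isZero_homology, 
      HomologicalComplex.exactAt_iff' _ (i+2) (i+1) i (by simp) (by simp)]
    have h := (projectiveResolution X).exact_succ i
    have : (ShortComplex.mk (((linearYoneda R (ModuleCat.{u} R)).obj I).map 
       ((projectiveResolution X).complex.d (i+1) i).op) 
       (((linearYoneda R (ModuleCat.{u} R)).obj I).map 
       ((projectiveResolution X).complex.d (i+2) (i+1)).op) (by
         rw [← Functor.map_comp, ← op_comp, HomologicalComplex.d_comp_d, op_zero, Functor.map_zero])).Exact := by
      rw [ShortComplex.moduleCat_exact_iff]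
      intro (x : _ ⟶ I) hx
      have hx : (projectiveResolution X).complex.d (i+2) (i+1) ≫ x = 0 := hx
      exact ⟨h.descToInjective x hx, h.comp_descToInjective x hx⟩
    exact this.op
  exact (this.of_iso (KHiso (GY I) X (i+1))).unop

lemma H_inj (a : Ideal R) (I : ModuleCat.{u} R) [Injective I] (i : ℕ) (x : HH a (i+1) I) : x = 0 := by
  obtain ⟨t, e, rfl⟩ := H_rep _ _ _ x
  have : Subsingleton (EE (RQ a t) I (i+1)) := ModuleCat.subsingleton_of_isZero (EE_inj _ _ _)
  rw [Subsingleton.elim e 0, map_zero]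


instance (Y : ModuleCat.{u} R) : PreservesFiniteLimits ((linearYoneda R (ModuleCat.{u} R)).obj Y) := by
  have : PreservesFiniteLimits (((linearYoneda R (ModuleCat.{u} R)).obj Y) ⋙ forget _) :=
    inferInstanceAs (PreservesFiniteLimits (yoneda.obj Y))
  exact preservesFiniteLimits_of_reflects_of_preserves _ (forget _)

instance (Y : ModuleCat.{u} R) : PreservesFiniteColimits (GY Y) :=
  preservesFiniteColimits_rightOp _

instance (X Y : ModuleCat.{u} R) : IsIso (((GY Y).fromLeftDerivedZero).app X) := inferInstance
end DD
end LCHelp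

namespace LCHelp
section ZZ
open Limits Opposite localCohomology
section
variable {C D : Type*} [Category C] [Category D] [Abelian C] [Abelian D] [EnoughProjectives C]

def KO (F : C ⥤ D) [F.Additive] (X : C) : D :=
  ((F.mapHomologicalComplex (ComplexShape.down ℕ)).obj (projectiveResolution X).complex).opcycles 0
def KHO (F : C ⥤ D) [F.Additive] (X : C) : KH F X 0 ⟶ KO F X :=
  HomologicalComplex.homologyι _ 0
def KOF (F : C ⥤ D) [F.Additive] (X : C) : KO F X ⟶ F.obj X :=
  (projectiveResolution X).fromLeftDerivedZero' F
def KOn {F G : C ⥤ D} [F.Additive] [G.Additive] (α : F ⟶ G) (X : C) : KO F X ⟶ KO G X :=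
  HomologicalComplex.opcyclesMap ((NatTrans.mapHomologicalComplex α (ComplexShape.down ℕ)).app
      (projectiveResolution X).complex) 0

lemma fld_eq (F : C ⥤ D) [F.Additive] (X : C) : F.fromLeftDerivedZero.app X =
    (KHiso F X 0).hom ≫ KHO F X ≫ KOF F X :=
  (projectiveResolution X).fromLeftDerivedZero_eq F

lemma KHO_nat {F G : C ⥤ D} [F.Additive] [G.Additive] (α : F ⟶ G) (X : C) :
    KHnat α X 0 ≫ KHO G X = KHO F X ≫ KOn α X :=
  HomologicalComplex.homologyι_naturality _ _

def Kp (F : C ⥤ D) [F.Additive] (X : C) : F.obj ((projectiveResolution X).complex.X 0) ⟶ KO F X :=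
  HomologicalComplex.pOpcycles ((F.mapHomologicalComplex (ComplexShape.down ℕ)).obj (projectiveResolution X).complex) 0

instance (F : C ⥤ D) [F.Additive] (X : C) : Epi (Kp F X) :=
  inferInstanceAs (Epi (HomologicalComplex.pOpcycles ((F.mapHomologicalComplex (ComplexShape.down ℕ)).obj (projectiveResolution X).complex) 0))

lemma Kp_F (F : C ⥤ D) [F.Additive] (X : C) : Kp F X ≫ KOF F X =
    F.map ((projectiveResolution X).π.f 0) :=
  ProjectiveResolution.pOpcycles_comp_fromLeftDerivedZero' (projectiveResolution X) F

lemma Kp_n {F G : C ⥤ D} [F.Additive] [G.Additive] (α : F ⟶ G) (X : C) :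
    Kp F X ≫ KOn α X = α.app _ ≫ Kp G X :=
  HomologicalComplex.p_opcyclesMap ((NatTrans.mapHomologicalComplex α (ComplexShape.down ℕ)).app
      (projectiveResolution X).complex) 0

lemma KOF_nat {F G : C ⥤ D} [F.Additive] [G.Additive] (α : F ⟶ G) (X : C) :
    KOn α X ≫ KOF G X = KOF F X ≫ α.app X := by
  rw [← cancel_epi (Kp F X), reassoc_of% Kp_n, Kp_F, reassoc_of% Kp_F]
  exact (α.naturality _).symm

lemma fld_nat {F G : C ⥤ D} [F.Additive] [G.Additive] (α : F ⟶ G) (X : C) :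
    (NatTrans.leftDerived α 0).app X ≫ G.fromLeftDerivedZero.app X =
      F.fromLeftDerivedZero.app X ≫ α.app X := by
  rw [fld_eq, fld_eq, KH_nat]
  simp only [Category.assoc, Iso.inv_hom_id_assoc]
  rw [reassoc_of% KHO_nat, KOF_nat]
end
variable {R : Type u} [CommRing R]

def ηη (X Y : ModuleCat.{u} R) : ModuleCat.of R (X ⟶ Y) ⟶ EE X Y 0 :=
  (((GY Y).fromLeftDerivedZero).app X).unop

instance (X Y : ModuleCat.{u} R) : IsIso (ηη X Y) :=
  inferInstanceAs (IsIso (((GY Y).fromLeftDerivedZero).app X).unop)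

lemma ηη_x {X X' : ModuleCat.{u} R} (h : X ⟶ X') (Y : ModuleCat.{u} R) (φ : X' ⟶ Y) :
    EEx h Y 0 (ηη X' Y φ) = ηη X Y (h ≫ φ : X ⟶ Y) := by
  have := congrArg Quiver.Hom.unop (((GY Y).fromLeftDerivedZero).naturality h)
  exact (ConcreteCategory.congr_hom this φ)

lemma ηη_y (X : ModuleCat.{u} R) {Y Y' : ModuleCat.{u} R} (f : Y ⟶ Y') (φ : X ⟶ Y) :
    EEy X f 0 (ηη X Y φ) = ηη X Y' (φ ≫ f : X ⟶ Y') := by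
  have := congrArg Quiver.Hom.unop (fld_nat (GM f) X)
  exact (ConcreteCategory.congr_hom this φ).symm.symm

lemma ηη_bij (X Y : ModuleCat.{u} R) : Function.Bijective (ηη X Y) :=
  ConcreteCategory.bijective_of_isIso (ηη X Y)

variable (a : Ideal R)

def RQone (t : (ℕᵒᵖ)ᵒᵖ) : RQ a t := Ideal.Quotient.mk (a ^ (unop (unop t))) 1

def ev1 (t : (ℕᵒᵖ)ᵒᵖ) (Y : ModuleCat.{u} R) : ModuleCat.of R (RQ a t ⟶ Y) ⟶ Y :=
  ModuleCat.ofHom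
    { toFun := fun φ : RQ a t ⟶ Y => φ.hom (RQone a t)
      map_add' := fun _ _ => rfl
      map_smul' := fun _ _ => rfl }

def εε (Y : ModuleCat.{u} R) : HH a 0 Y ⟶ Y :=
  Hdesc a 0 Y Y (fun t => inv (ηη (RQ a t) Y) ≫ ev1 a t Y) (by
    intro t s h
    rw [← cancel_epi (ηη (RQ a t) Y)]
    ext (φ : RQ a t ⟶ Y)
    simp only [IsIso.hom_inv_id_assoc]
    rw [← Category.assoc, ConcreteCategory.comp_apply, ConcreteCategory.comp_apply,
      ConcreteCategory.comp_apply, ηη_x, 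
      ← ConcreteCategory.comp_apply, ← ConcreteCategory.comp_apply, IsIso.hom_inv_id_assoc]
    rfl)

lemma εε_apply (Y : ModuleCat.{u} R) (t) (φ : RQ a t ⟶ Y) :
    εε a Y (Hι a 0 Y t (ηη (RQ a t) Y φ)) = φ.hom (RQone a t) := by
  rw [← ConcreteCategory.comp_apply, εε, Hdesc_ι, ← ConcreteCategory.comp_apply,
    IsIso.hom_inv_id_assoc]
  rfl

lemma H0_rep (Y : ModuleCat.{u} R) (x : HH a 0 Y) : ∃ t, ∃ φ : RQ a t ⟶ Y, 
    x = Hι a 0 Y t (ηη (RQ a t) Y φ) := by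
  obtain ⟨t, e, rfl⟩ := H_rep _ _ _ x
  obtain ⟨φ, rfl⟩ := (ηη_bij (RQ a t) Y).2 e
  exact ⟨t, φ, rfl⟩

lemma εε_nat {Y Y' : ModuleCat.{u} R} (f : Y ⟶ Y') (x : HH a 0 Y) :
    εε a Y' ((localCohomology a 0).map f x) = f (εε a Y x) := by
  obtain ⟨t, φ, rfl⟩ := H0_rep _ _ x
  rw [εε_apply, ← ConcreteCategory.comp_apply (Hι a 0 Y t), ← Hι_nat, ConcreteCategory.comp_apply, ηη_y, εε_apply]
  rfl

lemma RQ_hom_ext {t} {Y : ModuleCat.{u} R} (φ : RQ a t ⟶ Y) (h : φ.hom (RQone a t) = 0) : φ = 0 := by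
  ext (x : R ⧸ a ^ (unop (unop t)))
  obtain ⟨r, rfl⟩ := Ideal.Quotient.mk_surjective x
  have : (Ideal.Quotient.mk (a ^ (unop (unop t))) r : RQ a t) = r • RQone a t := by
    change _ = Ideal.Quotient.mk (a ^ (unop (unop t))) (r • 1)
    simp
  rw [this, map_smul, h]
  simp

lemma εε_inj (Y : ModuleCat.{u} R) : Function.Injective (εε a Y) := by
  rw [injective_iff_map_eq_zero]
  intro x hx
  obtain ⟨t, φ, rfl⟩ := H0_rep _ _ x
  rw [εε_apply] at hx
  rw [RQ_hom_ext a φ hx]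
  rw [map_zero, map_zero]

lemma εε_range (Y : ModuleCat.{u} R) (y : Y) :
    (∃ x, εε a Y x = y) ↔ ∃ t : ℕ, ∀ r ∈ a ^ t, r • y = 0 := by
  constructor
  · rintro ⟨x, rfl⟩
    obtain ⟨t, φ, rfl⟩ := H0_rep _ _ x
    refine ⟨unop (unop t), fun r hr => ?_⟩
    rw [εε_apply, ← map_smul]
    have : r • RQone a t = 0 := by
      change Ideal.Quotient.mk (a ^ (unop (unop t))) (r • 1) = 0
      rw [Ideal.Quotient.eq_zero_iff_mem]
      simpa using hr
    rw [this, map_zero]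
  · rintro ⟨t, ht⟩
    let φ : RQ a (op (op t)) ⟶ Y := ModuleCat.ofHom
      (Submodule.liftQ (a ^ t) (LinearMap.toSpanSingleton R Y y) (fun r hr => ht r hr))
    refine ⟨Hι a 0 Y _ (ηη _ Y φ), ?_⟩
    rw [εε_apply]
    change (Submodule.liftQ (a ^ t) (LinearMap.toSpanSingleton R Y y) _) (Submodule.Quotient.mk 1) = y
    exact one_smul R y
end ZZ
end LCHelp

namespace LCHelp
section FF
open Limits Opposite
variable {R : Type u} [CommRing R]

abbrev H (a : Ideal R) (i : ℕ) (M : Type u) [AddCommGroup M] [Module R M] : Type u :=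
  ((localCohomology a i).obj (ModuleCat.of R M))

variable {L M N : Type u} [AddCommGroup L] [Module R L] [AddCommGroup M] [Module R M]
  [AddCommGroup N] [Module R N] (a : Ideal R)

def Hm (a : Ideal R) (i : ℕ) (f : M →ₗ[R] N) : H a i M →ₗ[R] H a i N :=
  ((localCohomology a i).map (ModuleCat.ofHom f)).hom

lemma Hm_id (i : ℕ) : Hm a i (LinearMap.id : M →ₗ[R] M) = LinearMap.id := by
  have := (localCohomology a i).map_id (ModuleCat.of R M)
  exact congrArg ModuleCat.Hom.hom this

lemma Hm_comp (i : ℕ) (g : M →ₗ[R] L) (f : N →ₗ[R] M) : Hm a i (g ∘ₗ f) = Hm a i g ∘ₗ Hm a i f := by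
  have := (localCohomology a i).map_comp (ModuleCat.ofHom f) (ModuleCat.ofHom g)
  exact congrArg ModuleCat.Hom.hom this

lemma Hm_smul_id (i : ℕ) (r : R) : Hm a i (r • LinearMap.id : M →ₗ[R] M) = r • LinearMap.id := by
  have := H_smul a i (ModuleCat.of R M) r
  exact congrArg ModuleCat.Hom.hom this

lemma Hm_smul (i : ℕ) (r : R) (f : M →ₗ[R] N) : Hm a i (r • f) = r • Hm a i f := by
  have : r • f = (r • LinearMap.id : N →ₗ[R] N) ∘ₗ f := by ext; simp
  rw [this, Hm_comp, Hm_smul_id]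
  ext; simp

def He (i : ℕ) (e : M ≃ₗ[R] N) : H a i M ≃ₗ[R] H a i N :=
  LinearEquiv.ofLinearMap (Hm a i e.toLinearMap) (Hm a i e.symm.toLinearMap)
    (by rw [← Hm_comp]; simp [Hm_id]) (by rw [← Hm_comp]; simp [Hm_id])

lemma LES {f : N →ₗ[R] M} {g : M →ₗ[R] L} (hf : Function.Injective f) (hg : Function.Surjective g)
    (hfg : Function.Exact f g) (i : ℕ) : ∃ d : H a i L →ₗ[R] H a (i+1) N,
    Function.Exact (Hm a i g) d ∧ Function.Exact d (Hm a (i+1) f) := by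
  let S : ShortComplex (ModuleCat.{u} R) := ShortComplex.mk (ModuleCat.ofHom f) (ModuleCat.ofHom g)
    (by ext x; exact hfg.apply_apply_eq_zero x)
  have hS : S.ShortExact := by
    refine ShortComplex.ShortExact.mk' ?_ ?_ ?_
    · rw [ShortComplex.moduleCat_exact_iff]
      intro x hx
      exact (hfg x).1 hx
    · rw [ModuleCat.mono_iff_injective]; exact hf
    · rw [ModuleCat.epi_iff_surjective]; exact hg
  exact ⟨(Hδ a hS i).hom, H_ex3 a hS i, H_ex1 a hS i⟩

lemma LES2 {f : N →ₗ[R] M} {g : M →ₗ[R] L} (hf : Function.Injective f) (hg : Function.Surjective g)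
    (hfg : Function.Exact f g) (i : ℕ) : Function.Exact (Hm a i f) (Hm a i g) := by
  let S : ShortComplex (ModuleCat.{u} R) := ShortComplex.mk (ModuleCat.ofHom f) (ModuleCat.ofHom g)
    (by ext x; exact hfg.apply_apply_eq_zero x)
  have hS : S.ShortExact := by
    refine ShortComplex.ShortExact.mk' ?_ ?_ ?_
    · rw [ShortComplex.moduleCat_exact_iff]
      intro x hx
      exact (hfg x).1 hx
    · rw [ModuleCat.mono_iff_injective]; exact hf
    · rw [ModuleCat.epi_iff_surjective]; exact hg
  exact H_ex2 a hS i

lemma H_injective (I : Type u) [AddCommGroup I] [Module R I] [Module.Injective R I] (i : ℕ) :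
    Subsingleton (H a (i+1) I) := by
  have := Module.injective_object_of_injective_module R I
  exact ⟨fun x y => (H_inj a (ModuleCat.of R I) i x).trans (H_inj a (ModuleCat.of R I) i y).symm⟩

def ε (a : Ideal R) (M : Type u) [AddCommGroup M] [Module R M] : H a 0 M →ₗ[R] M := (εε a (ModuleCat.of R M)).hom

lemma ε_inj : Function.Injective (ε a M) := εε_inj a (ModuleCat.of R M)
lemma ε_nat (f : M →ₗ[R] N) (x : H a 0 M) : ε a N (Hm a 0 f x) = f (ε a M x) :=
  εε_nat a (ModuleCat.ofHom f) x
lemma ε_range (m : M) : (∃ x, ε a M x = m) ↔ ∃ t : ℕ, ∀ r ∈ a ^ t, r • m = 0 :=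
  εε_range a (ModuleCat.of R M) m

lemma sameRad [IsNoetherianRing R] {a b : Ideal R} (h : a.radical = b.radical) (i : ℕ)
    (M : Type u) [AddCommGroup M] [Module R M] : Nonempty (H a i M ≃ₗ[R] H b i M) :=
  ⟨((localCohomology.isoOfSameRadical h i).app (ModuleCat.of R M)).toLinearEquiv⟩

lemma enoughInj (M : Type u) [AddCommGroup M] [Module R M] : ∃ (I : Type u) (_ : AddCommGroup I) (_ : Module R I)
   (_ : Module.Injective R I) (f : M →ₗ[R] I), Function.Injective f := by
  obtain ⟨p⟩ := EnoughInjectives.presentation (ModuleCat.of R M)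
  refine ⟨p.J, inferInstance, inferInstance, ?_, p.f.hom, ?_⟩
  · have := p.injective
    exact Module.injective_module_of_injective_object R p.J
  · exact (ModuleCat.mono_iff_injective p.f).1 p.mono
end FF
end LCHelp

namespace LCHelp
section GG
variable {R : Type u} [CommRing R]
variable {L M N : Type u} [AddCommGroup L] [Module R L] [AddCommGroup M] [Module R M]
  [AddCommGroup N] [Module R N] (a : Ideal R)

lemma exact_bij {A B C D : Type u} [AddCommGroup A] [Module R A] [AddCommGroup B] [Module R B]
    [AddCommGroup C] [Module R C] [AddCommGroup D] [Module R D]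
    {f : A →ₗ[R] B} {g : B →ₗ[R] C} {h : C →ₗ[R] D} (h1 : Function.Exact f g) (h2 : Function.Exact g h)
    [Subsingleton A] [Subsingleton D] : Nonempty (B ≃ₗ[R] C) := by
  refine ⟨LinearEquiv.ofBijective g ⟨?_, ?_⟩⟩
  · rw [injective_iff_map_eq_zero]
    intro x hx
    obtain ⟨y, rfl⟩ := (h1 x).1 hx
    rw [Subsingleton.elim y 0, map_zero]
  · intro y
    exact (h2 y).1 (Subsingleton.elim _ _)

lemma exact_subsingleton {A B C : Type u} [AddCommGroup A] [Module R A] [AddCommGroup B] [Module R B]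
    [AddCommGroup C] [Module R C] {f : A →ₗ[R] B} {g : B →ₗ[R] C} (h1 : Function.Exact f g)
    [Subsingleton A] [Subsingleton C] : Subsingleton B := by
  refine subsingleton_of_forall_eq 0 fun x => ?_
  obtain ⟨y, rfl⟩ := (h1 x).1 (Subsingleton.elim _ _)
  rw [Subsingleton.elim y 0, map_zero]

/-- torsion submodule -/
def Gam (a : Ideal R) (M : Type u) [AddCommGroup M] [Module R M] : Submodule R M where
  carrier := {m | ∃ t : ℕ, ∀ r ∈ a ^ t, r • m = 0}
  add_mem' := by
    rintro x y ⟨s, hs⟩ ⟨t, ht⟩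
    refine ⟨s + t, fun r hr => ?_⟩
    rw [smul_add, hs r (Ideal.pow_le_pow_right (by omega) hr),
      ht r (Ideal.pow_le_pow_right (by omega) hr), add_zero]
  zero_mem' := ⟨0, by simp⟩
  smul_mem' := by
    rintro c x ⟨s, hs⟩
    exact ⟨s, fun r hr => by rw [smul_comm, hs r hr, smul_zero]⟩

lemma mem_Gam {m : M} : m ∈ Gam a M ↔ ∃ t : ℕ, ∀ r ∈ a ^ t, r • m = 0 := Iff.rfl

lemma ε_range' (m : M) : (∃ x, ε a M x = m) ↔ m ∈ Gam a M := ε_range a m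

lemma Gam_Gam (x : Gam a M) : x ∈ Gam a (Gam a M) := by
  obtain ⟨t, ht⟩ := x.2
  exact ⟨t, fun r hr => Subtype.ext (ht r hr)⟩

lemma Gam_quot (hM : ∀ m : M, m ∈ Gam a M) (K : Submodule R M) (x : M ⧸ K) : x ∈ Gam a (M ⧸ K) := by
  obtain ⟨m, rfl⟩ := K.mkQ_surjective x
  obtain ⟨t, ht⟩ := hM m
  exact ⟨t, fun r hr => by rw [← map_smul, ht r hr, map_zero]⟩

lemma H_tors (i : ℕ) : ∀ (M : Type u) [AddCommGroup M] [Module R M] (x : H a i M), x ∈ Gam a (H a i M) := by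
  induction i with
  | zero =>
    intro M _ _ x
    obtain ⟨t, ht⟩ := (ε_range a (ε a M x)).1 ⟨x, rfl⟩
    refine ⟨t, fun r hr => ε_inj a ?_⟩
    rw [map_smul, ht r hr, map_zero]
  | succ i ih =>
    intro M _ _ x
    obtain ⟨I, _, _, _, f, hf⟩ := enoughInj (R := R) M
    obtain ⟨d, h1, h2⟩ := LES a hf (f.range.mkQ_surjective) (LinearMap.exact_map_mkQ_range f) i
    have := H_injective a I i
    obtain ⟨y, rfl⟩ := (h2 x).1 (Subsingleton.elim _ _)
    obtain ⟨t, ht⟩ := ih _ y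
    exact ⟨t, fun r hr => by rw [← map_smul, ht r hr, map_zero]⟩

lemma Gam_injective [IsNoetherianRing R] (c : Ideal R) (I : Type u) [AddCommGroup I] [Module R I]
    [Module.Injective R I] : Module.Injective R (Gam c I) := by
  apply Module.Baer.injective
  intro J g
  have hfin : ∃ t, ∀ j : J, ∀ r ∈ c ^ t, r • g j = 0 := by
    obtain ⟨s, hs⟩ := (IsNoetherian.noetherian (⊤ : Submodule R J))
    choose T hT using fun j : J => (g j).2
    refine ⟨s.sup T, fun j r hr => ?_⟩
    have hj : j ∈ Submodule.span R (s : Set J) := by rw [hs]; trivial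
    induction hj using Submodule.span_induction with
    | mem x hx => 
      apply Subtype.ext
      exact hT x r (Ideal.pow_le_pow_right (Finset.le_sup (f := T) hx) hr)
    | zero => simp
    | add x y _ _ h1 h2 => rw [map_add, smul_add, h1, h2, add_zero]
    | smul q x _ h => rw [map_smul, smul_comm, h, smul_zero]
  obtain ⟨t, ht⟩ := hfin
  obtain ⟨k, hk⟩ := Ideal.exists_pow_inf_eq_pow_smul c (J : Submodule R R)
  have hk' := hk (k + t) (by omega)
  let f0 : J →ₗ[R] (R ⧸ c ^ (k + t)) := (Submodule.mkQ (c ^ (k+t))) ∘ₗ J.subtype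
  have hker : f0.ker ≤ ((Gam c I).subtype ∘ₗ g).ker := by
    intro j hj
    have h1 : (j : R) ∈ c ^ (k + t) := by
      have : Submodule.Quotient.mk (p := c ^ (k+t)) (j : R) = 0 := hj
      rwa [Submodule.Quotient.mk_eq_zero] at this
    have h2 : (j : R) ∈ c ^ t • (J : Submodule R R) := by
      have : (j : R) ∈ c ^ (k + t) • ⊤ ⊓ (J : Submodule R R) := ⟨by simpa using h1, j.2⟩
      rw [hk'] at this
      rw [show k + t - k = t by omega] at this
      exact Submodule.smul_mono le_rfl inf_le_right this
    have h3 : ∀ x ∈ c ^ t • (J : Submodule R R), ∃ h : x ∈ J, g ⟨x, h⟩ = 0 := by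
      intro x hx
      induction hx using Submodule.smul_induction_on' with
      | smul r hr n hn =>
        refine ⟨J.smul_mem _ hn, ?_⟩
        have : (⟨r • n, J.smul_mem _ hn⟩ : J) = r • ⟨n, hn⟩ := rfl
        rw [this, map_smul, ht _ _ hr]
      | add x _ y _ h1 h2 =>
        obtain ⟨p, hp⟩ := h1
        obtain ⟨q, hq⟩ := h2
        refine ⟨J.add_mem p q, ?_⟩
        have : (⟨x + y, J.add_mem p q⟩ : J) = ⟨x, p⟩ + ⟨y, q⟩ := rfl
        rw [this, map_add, hp, hq, add_zero]
    obtain ⟨_, h4⟩ := h3 _ h2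
    have h4 : g j = 0 := h4
    simp [h4]
  obtain ⟨h, hh⟩ := Module.Injective.out (Q := I) (f0.ker.liftQ f0 le_rfl)
    (by rw [← LinearMap.ker_eq_bot]; exact Submodule.ker_liftQ_eq_bot _ _ _ le_rfl)
    (f0.ker.liftQ ((Gam c I).subtype ∘ₗ g) hker)
  refine ⟨(h ∘ₗ Submodule.mkQ (c ^ (k+t))).codRestrict _ ?_, ?_⟩
  · intro x
    refine ⟨k + t, fun r hr => ?_⟩
    rw [LinearMap.comp_apply, ← map_smul, ← map_smul]
    have : Submodule.mkQ (c ^ (k+t)) (r • x) = 0 := by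
      rw [Submodule.mkQ_apply, Submodule.Quotient.mk_eq_zero, smul_eq_mul]
      exact Ideal.mul_mem_right _ _ hr
    rw [this, map_zero]
  · intro x hx
    apply Subtype.ext
    have := hh (Submodule.Quotient.mk ⟨x, hx⟩)
    exact this

lemma tors_embed [IsNoetherianRing R] (c : Ideal R) (M : Type u) [AddCommGroup M] [Module R M] 
    (hM : ∀ m : M, m ∈ Gam c M) : ∃ (I : Type u) (_ : AddCommGroup I) (_ : Module R I)
   (_ : Module.Injective R I) (f : M →ₗ[R] I), Function.Injective f ∧ ∀ m : I, m ∈ Gam c I := by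
  obtain ⟨I, _, _, _, f, hf⟩ := enoughInj (R := R) M
  refine ⟨Gam c I, inferInstance, inferInstance, Gam_injective c I, f.codRestrict _ ?_, ?_, Gam_Gam c⟩
  · intro x
    obtain ⟨t, ht⟩ := hM x
    exact ⟨t, fun r hr => by rw [← map_smul, ht r hr, map_zero]⟩
  · intro x y h
    exact hf (congrArg Subtype.val h)

lemma H_acyc [IsNoetherianRing R] (i : ℕ) : ∀ (M : Type u) [AddCommGroup M] [Module R M] 
    (_ : ∀ m : M, m ∈ Gam a M), Subsingleton (H a (i+1) M) := by
  induction i with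
  | zero =>
    intro M _ _ hM
    obtain ⟨I, _, _, _, f, hf, hI⟩ := tors_embed (R := R) a M hM
    obtain ⟨d, h1, h2⟩ := LES a hf (f.range.mkQ_surjective) (LinearMap.exact_map_mkQ_range f) 0
    have := H_injective a I 0
    refine subsingleton_of_forall_eq 0 fun x => ?_
    obtain ⟨y, rfl⟩ := (h2 x).1 (Subsingleton.elim _ _)
    rw [h1 y]
    obtain ⟨z, hz⟩ := f.range.mkQ_surjective (ε a _ y)
    obtain ⟨z', rfl⟩ := (ε_range' a z).2 (hI z)
    exact ⟨z', ε_inj a (by rw [ε_nat, hz])⟩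
  | succ i ih =>
    intro M _ _ hM
    obtain ⟨I, _, _, _, f, hf, hI⟩ := tors_embed (R := R) a M hM
    obtain ⟨d, h1, h2⟩ := LES a hf (f.range.mkQ_surjective) (LinearMap.exact_map_mkQ_range f) (i+1)
    have := H_injective a I (i+1)
    have := ih _ (Gam_quot a hI f.range)
    exact exact_subsingleton h2

lemma E0 {a b : Ideal R} (h : Gam a M = Gam b M) : 
    ∃ e : H a 0 M ≃ₗ[R] H b 0 M, ∀ x, ε b M (e x) = ε a M x := by
  have h1 : (ε a M).range = (ε b M).range := by
    ext m
    simp only [LinearMap.mem_range]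
    rw [ε_range', ε_range', h]
  refine ⟨(LinearEquiv.ofInjective _ (ε_inj a)).trans ((LinearEquiv.ofEq _ _ h1).trans 
    (LinearEquiv.ofInjective _ (ε_inj b)).symm), fun x => ?_⟩
  have : ∀ y : (ε b M).range, ε b M ((LinearEquiv.ofInjective _ (ε_inj b)).symm y) = y := by
    intro y
    have := LinearEquiv.apply_symm_apply (LinearEquiv.ofInjective _ (ε_inj b)) y
    exact congrArg Subtype.val this
  simp [this]

lemma Gam_sup (c : Ideal R) (hM : ∀ m : M, m ∈ Gam c M) : Gam a M = Gam (a ⊔ c) M := by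
  ext m
  constructor
  · rintro ⟨s, hs⟩
    obtain ⟨t, ht⟩ := hM m
    refine ⟨s + t, fun r hr => ?_⟩
    have := Ideal.sup_pow_add_le_pow_sup_pow hr
    obtain ⟨x, hx, y, hy, rfl⟩ := Submodule.mem_sup.1 this
    rw [add_smul, hs x hx, ht y hy, add_zero]
  · rintro ⟨s, hs⟩
    exact ⟨s, fun r hr => hs r (Ideal.pow_right_mono le_sup_left _ hr)⟩

lemma C2 [IsNoetherianRing R] (c : Ideal R) (i : ℕ) : ∀ (M : Type u) [AddCommGroup M] [Module R M] 
    (_ : ∀ m : M, m ∈ Gam c M), Nonempty (H a i M ≃ₗ[R] H (a ⊔ c) i M) := by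
  induction i with
  | zero =>
    intro M _ _ hM
    obtain ⟨e, _⟩ := E0 (Gam_sup a c hM)
    exact ⟨e⟩
  | succ i ih =>
    intro M _ _ hM
    obtain ⟨I, _, _, _, f, hf, hI⟩ := tors_embed (R := R) c M hM
    obtain ⟨d, h1, h2⟩ := LES a hf (f.range.mkQ_surjective) (LinearMap.exact_map_mkQ_range f) i
    obtain ⟨d', h1', h2'⟩ := LES (a ⊔ c) hf (f.range.mkQ_surjective) (LinearMap.exact_map_mkQ_range f) i
    have := H_injective a I i
    have := H_injective (a ⊔ c) I i
    have hC := Gam_quot c hI f.range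
    cases i with
    | zero =>
      obtain ⟨e, he⟩ := E0 (Gam_sup a c hC)
      have hd : Function.Surjective d := fun y => (h2 y).1 (Subsingleton.elim _ _)
      have hd' : Function.Surjective d' := fun y => (h2' y).1 (Subsingleton.elim _ _)
      obtain ⟨e1, he1⟩ := E0 (Gam_sup a c hI)
      refine ⟨(LinearMap.quotKerEquivOfSurjective d hd).symm.trans ((Submodule.Quotient.equiv _ _ e ?_).trans
        (LinearMap.quotKerEquivOfSurjective d' hd'))⟩
      rw [LinearMap.exact_iff.1 h1, LinearMap.exact_iff.1 h1']
      have key : ∀ x, e (Hm a 0 f.range.mkQ x) = Hm (a ⊔ c) 0 f.range.mkQ (e1 x) := by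
        intro x
        apply ε_inj
        rw [he, ε_nat, ε_nat, he1]
      ext y
      constructor
      · rintro ⟨_, ⟨x, rfl⟩, rfl⟩
        exact ⟨e1 x, (key x).symm⟩
      · rintro ⟨x, rfl⟩
        refine ⟨_, ⟨e1.symm x, rfl⟩, ?_⟩
        change e _ = _
        rw [key, LinearEquiv.apply_symm_apply]
    | succ i =>
      have := H_injective a I i
      have := H_injective (a ⊔ c) I i
      obtain ⟨e⟩ := ih _ hC
      obtain ⟨p⟩ := exact_bij h1 h2
      obtain ⟨q⟩ := exact_bij h1' h2'
      exact ⟨p.symm.trans (e.trans q)⟩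
end GG
end LCHelp

namespace LCHelp
section HH1
variable {R : Type u} [CommRing R] 

lemma devissage [IsNoetherianRing R] (T : (N : Type u) → [AddCommGroup N] → [Module R N] → Prop)
    (hiso : ∀ (N N' : Type u) [AddCommGroup N] [Module R N] [AddCommGroup N'] [Module R N'], (N ≃ₗ[R] N') → T N → T N')
    (h0 : ∀ (N : Type u) [AddCommGroup N] [Module R N] [Subsingleton N], T N)
    (hext : ∀ (N₁ N₂ N₃ : Type u) [AddCommGroup N₁] [Module R N₁] [AddCommGroup N₂] [Module R N₂] 
      [AddCommGroup N₃] [Module R N₃] (f : N₁ →ₗ[R] N₂) (g : N₂ →ₗ[R] N₃), Function.Injective f → 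
      Function.Surjective g → Function.Exact f g → T N₁ → T N₃ → T N₂)
    (M : Type u) [AddCommGroup M] [Module R M] [hM : Module.Finite R M] 
    (h : ∀ p ∈ Module.support R M, T (R ⧸ p.asIdeal)) : T M := by
  revert h
  induction hM using IsNoetherianRing.induction_on_isQuotientEquivQuotientPrime R with
  | subsingleton N => intro _; exact h0 N
  | quotient N p e =>
    intro h
    refine hiso _ _ e.symm (h p ?_)
    rw [e.support_eq, Module.mem_support_iff_of_finite, Ideal.annihilator_quotient]
  | exact N₁ N₂ N₃ f g hf hg hfg h1 h3 =>
    intro h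
    rw [Module.support_of_exact hfg hf hg] at h
    exact hext _ _ _ f g hf hg hfg (h1 fun p hp => h p (Or.inl hp)) (h3 fun p hp => h p (Or.inr hp))

/-- multiplication by x. -/
abbrev mulx (p : Ideal R) (x : R) : (R ⧸ p) →ₗ[R] (R ⧸ p) := x • LinearMap.id

lemma mulx_inj (p : Ideal R) [p.IsPrime] {x : R} (hx : x ∉ p) : Function.Injective (mulx p x) := by
  rw [← LinearMap.ker_eq_bot, LinearMap.ker_eq_bot']
  intro y hy
  obtain ⟨y, rfl⟩ := Ideal.Quotient.mk_surjective y
  have : Ideal.Quotient.mk p (x * y) = 0 := hy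
  rw [Ideal.Quotient.eq_zero_iff_mem] at this ⊢
  exact ((‹p.IsPrime›.mem_or_mem this).resolve_left hx)

lemma supp_mulx [IsNoetherianRing R] (p : Ideal R) (x : R) (q : PrimeSpectrum R) 
    (hq : q ∈ Module.support R ((R ⧸ p) ⧸ (mulx p x).range)) : p ≤ q.asIdeal ∧ x ∈ q.asIdeal := by
  rw [Module.mem_support_iff_of_finite] at hq
  constructor
  · intro r hr
    apply hq
    rw [Module.mem_annihilator]
    intro m
    obtain ⟨m, rfl⟩ := Submodule.mkQ_surjective _ m
    obtain ⟨m, rfl⟩ := Ideal.Quotient.mk_surjective m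
    rw [← map_smul]
    have : r • Ideal.Quotient.mk p m = 0 := by
      change Ideal.Quotient.mk p (r * m) = 0
      rw [Ideal.Quotient.eq_zero_iff_mem]
      exact p.mul_mem_right _ hr
    rw [this, map_zero]
  · apply hq
    rw [Module.mem_annihilator]
    intro m
    obtain ⟨m, rfl⟩ := Submodule.mkQ_surjective _ m
    rw [← map_smul]
    exact (Submodule.Quotient.mk_eq_zero _).2 ⟨m, rfl⟩

lemma coh_lt {p q : PrimeSpectrum R} (h : p.asIdeal ≤ q.asIdeal) {x : R} (hx : x ∉ p.asIdeal) (hxq : x ∈ q.asIdeal)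
    {n : ℕ} (hp : Order.coheight p ≤ (n + 1 : ℕ)) : Order.coheight q ≤ (n : ℕ) := by
  have hlt : p < q := lt_of_le_of_ne h (fun e => hx (e ▸ hxq))
  have := (Order.coheight_add_one_le hlt).trans hp
  push_cast at this
  exact (ENat.add_le_add_iff_right (by simp)).1 this

lemma R_tors {a p : Ideal R} (h : a ≤ p) (m : R ⧸ p) : m ∈ Gam a (R ⧸ p) := by
  refine ⟨1, fun r hr => ?_⟩
  obtain ⟨m, rfl⟩ := Ideal.Quotient.mk_surjective m
  change Ideal.Quotient.mk p (r * m) = 0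
  rw [Ideal.Quotient.eq_zero_iff_mem]
  exact p.mul_mem_right _ (h (by simpa using hr))

lemma x_tors (a : Ideal R) (N : Type u) [AddCommGroup N] [Module R N] (hN : ∀ m, m ∈ Gam a N) {x : R} (hx : x ∈ a)
    (h : ∀ m : N, x • m = 0 → m = 0) : Subsingleton N := by
  refine subsingleton_of_forall_eq 0 fun m => ?_
  obtain ⟨t, ht⟩ := hN m
  have := ht _ (Ideal.pow_mem_pow hx t)
  clear ht
  induction t with
  | zero => simpa using this
  | succ t ih => 
    apply ih
    apply h
    rw [← mul_smul, ← pow_succ', this]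

lemma H_van_dev [IsNoetherianRing R] (a : Ideal R) (i : ℕ) 
    (M : Type u) [AddCommGroup M] [Module R M] [Module.Finite R M]
    (h : ∀ p ∈ Module.support R M, Subsingleton (H a i (R ⧸ p.asIdeal))) : Subsingleton (H a i M) := by
  refine devissage (R := R) (fun N _ _ => Subsingleton (H a i N)) ?_ ?_ ?_ M h
  · intro N N' _ _ _ _ e h
    exact (He a i e).symm.toEquiv.subsingleton
  · intro N _ _ _
    refine subsingleton_of_forall_eq 0 fun x => ?_
    have h1 : (LinearMap.id : N →ₗ[R] N) = (0 : R) • LinearMap.id := LinearMap.ext fun x => Subsingleton.elim _ _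
    have h2 := Hm_id (M := N) a i
    rw [h1, Hm_smul_id, zero_smul] at h2
    exact (congrArg (fun f => f x) h2).symm
  · intro N₁ N₂ N₃ _ _ _ _ _ _ f g hf hg hfg h1 h3
    exact exact_subsingleton (LES2 a hf hg hfg i)

lemma Groth_prime [IsNoetherianRing R] (a : Ideal R) (i : ℕ) : ∀ p : PrimeSpectrum R, Order.coheight p < (i : ℕ∞) → 
    Subsingleton (H a i (R ⧸ p.asIdeal)) := by
  induction i with
  | zero => intro p hp; simp at hp
  | succ i ih =>
    intro p hp
    by_cases hap : a ≤ p.asIdeal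
    · exact H_acyc a i _ (R_tors hap)
    obtain ⟨x, hxa, hxp⟩ := Set.not_subset.1 hap
    have hp' : Order.coheight p ≤ (i : ℕ∞) := by
      push_cast at hp; exact Order.le_of_lt_add_one hp
    have hL : Subsingleton (H a i ((R ⧸ p.asIdeal) ⧸ (mulx p.asIdeal x).range)) := by
      apply H_van_dev
      intro q hq
      apply ih
      obtain ⟨h1, h2⟩ := supp_mulx _ _ _ hq
      have hlt : p < q := lt_of_le_of_ne h1 (fun e => hxp (e ▸ h2))
      have h3 := (Order.coheight_add_one_le hlt).trans hp'
      exact (ENat.add_one_le_iff (ne_of_lt (lt_of_le_of_lt (le_self_add.trans h3) (ENat.natCast_lt_top i)))).1 h3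
    obtain ⟨d, h1, h2⟩ := LES a (mulx_inj p.asIdeal hxp) (Submodule.mkQ_surjective _) (LinearMap.exact_map_mkQ_range _) i
    refine x_tors a _ (H_tors a (i+1) _) hxa fun m hm => ?_
    have : Hm a (i+1) (mulx p.asIdeal x) m = 0 := by
      rw [Hm_smul_id]; exact hm
    obtain ⟨y, rfl⟩ := (h2 m).1 this
    rw [Subsingleton.elim y 0, map_zero]

lemma Groth [IsNoetherianRing R] (a : Ideal R) (i : ℕ)
    (M : Type u) [AddCommGroup M] [Module R M] [Module.Finite R M]
    (h : ∀ p ∈ Module.support R M, Order.coheight p < (i : ℕ∞)) : Subsingleton (H a i M) := 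
  H_van_dev a i M fun p hp => Groth_prime a i p (h p hp)
end HH1
end LCHelp

namespace LCHelp
section II1
variable {R : Type u} [CommRing R] 

lemma retract_injective {I E : Type u} [AddCommGroup I] [Module R I] [AddCommGroup E] [Module R E] [Module.Injective R I]
    (i : E →ₗ[R] I) (r : I →ₗ[R] E) (h : ∀ e, r (i e) = e) : Module.Injective R E := by
  refine ⟨fun X Y _ _ _ _ f hf g => ?_⟩
  obtain ⟨t, ht⟩ := Module.Injective.out (Q := I) f hf (i ∘ₗ g)
  exact ⟨r ∘ₗ t, fun x => by simp [ht, h]⟩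

/-- elementwise essential -/
def Ess {I : Type u} [AddCommGroup I] [Module R I] (K S : Submodule R I) : Prop :=
  ∀ e ∈ S, e ≠ 0 → ∃ r : R, r • e ∈ K ∧ r • e ≠ 0

lemma exists_ess {I : Type u} [AddCommGroup I] [Module R I] [Module.Injective R I] (K : Submodule R I) :
    ∃ E : Submodule R I, K ≤ E ∧ Ess K E ∧ Module.Injective R E := by
  have hz := zorn_le_nonempty₀ {S : Submodule R I | Ess K S} (fun c hc hc' y hy => by
    refine ⟨sSup c, ?_, fun z hz => le_sSup hz⟩
    intro e he h0
    rw [Submodule.mem_sSup_of_directed ⟨y, hy⟩ hc'.directedOn] at he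
    obtain ⟨S, hS, heS⟩ := he
    exact hc hS e heS h0) K (fun e he h0 => ⟨1, by simpa using he, by simpa using h0⟩)
  obtain ⟨E, hKE, hE, hmax⟩ := hz
  refine ⟨E, hKE, hE, ?_⟩
  have hz := zorn_le_nonempty₀ {S : Submodule R I | S ⊓ E = ⊥} (fun c hc hc' y hy => by
    refine ⟨sSup c, ?_, fun z hz => le_sSup hz⟩
    rw [Set.mem_ofPred_eq, eq_bot_iff]
    rintro e ⟨he, he'⟩
    rw [SetLike.mem_coe, Submodule.mem_sSup_of_directed ⟨y, hy⟩ hc'.directedOn] at he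
    obtain ⟨S, hS, heS⟩ := he
    have : S ⊓ E = ⊥ := hc hS
    rw [← this]
    exact ⟨heS, he'⟩) ⊥ (by simp)
  obtain ⟨F, -, hF, hFmax⟩ := hz
  have hF : F ⊓ E = ⊥ := hF
  let i : E →ₗ[R] I ⧸ F := F.mkQ ∘ₗ E.subtype
  have hi : Function.Injective i := by
    rw [← LinearMap.ker_eq_bot, LinearMap.ker_eq_bot']
    intro e he
    have : (e : I) ∈ F := (Submodule.Quotient.mk_eq_zero _).1 he
    have : (e : I) ∈ F ⊓ E := ⟨this, e.2⟩
    rw [hF] at this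
    exact Subtype.ext this
  obtain ⟨g, hg⟩ := Module.Injective.out (Q := I) i hi E.subtype
  have hess : ∀ y : I ⧸ F, y ≠ 0 → ∃ r : R, ∃ e : E, r • y = i e ∧ e ≠ 0 := by
    intro y hy
    by_contra hcon
    push Not at hcon
    obtain ⟨y, rfl⟩ := F.mkQ_surjective y
    have hyF : y ∉ F := fun h => hy ((Submodule.Quotient.mk_eq_zero _).2 h)
    have : (F ⊔ R ∙ y) ⊓ E = ⊥ := by
      rw [eq_bot_iff]
      rintro e ⟨he, he'⟩
      obtain ⟨f, hf, z, hz, rfl⟩ := Submodule.mem_sup.1 he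
      obtain ⟨r, rfl⟩ := Submodule.mem_span_singleton.1 hz
      have := hcon r ⟨_, he'⟩ (by
        change _ = F.mkQ (f + r • y)
        rw [map_add, map_smul, (show F.mkQ f = 0 from (Submodule.Quotient.mk_eq_zero _).2 hf), zero_add])
      exact congrArg Subtype.val this
    have h2 := hFmax this le_sup_left
    exact hyF (h2 (Submodule.mem_sup_right (Submodule.mem_span_singleton_self y)))
  have hgy : ∀ y : I ⧸ F, y ≠ 0 → ∃ r : R, r • g y ∈ K ∧ r • g y ≠ 0 := by
    intro y hy
    obtain ⟨r, e, h1, h2⟩ := hess y hy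
    obtain ⟨s, h3, h4⟩ := hE e e.2 (fun h => h2 (Subtype.ext h))
    have : (s * r) • g y = s • (e : I) := by
      rw [mul_smul, ← map_smul, h1, hg]; rfl
    exact ⟨s * r, this ▸ h3, this ▸ h4⟩
  have hr : Ess K g.range := by
    rintro _ ⟨y, rfl⟩ h0
    exact hgy y (fun h => h0 (by rw [h, map_zero]))
  have hEr : E ≤ g.range := fun e he => ⟨i ⟨e, he⟩, hg _⟩
  have hle := hmax hr hEr
  refine retract_injective E.subtype ((g ∘ₗ F.mkQ).codRestrict E fun x => hle ⟨_, rfl⟩) fun e => Subtype.ext (hg e)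

/-- residue field -/
abbrev kk (R : Type u) [CommRing R] [IsLocalRing R] := R ⧸ IsLocalRing.maximalIdeal R

lemma exE (R : Type u) [CommRing R] [IsLocalRing R] [IsNoetherianRing R] : 
    ∃ (E : Type u) (_ : AddCommGroup E) (_ : Module R E) (_ : Module.Injective R E) (j : kk R →ₗ[R] E),
      Function.Injective j ∧ Module.Finite R (kk R →ₗ[R] E) := by
  obtain ⟨I, _, _, _, f, hf⟩ := enoughInj (R := R) (kk R)
  obtain ⟨E, hKE, hE, hEi⟩ := exists_ess f.range
  refine ⟨E, inferInstance, inferInstance, hEi, f.codRestrict E (fun x => hKE ⟨x, rfl⟩), ?_, ?_⟩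
  · intro x y h
    exact hf (congrArg Subtype.val h)
  have key : ∀ φ : kk R →ₗ[R] E, (φ 1 : I) ∈ f.range := by
    intro φ
    by_cases h0 : (φ 1 : I) = 0
    · rw [h0]; exact zero_mem _
    obtain ⟨r, h1, h2⟩ := hE (φ 1) (φ 1).2 h0
    have hr : IsUnit r := by
      by_contra hr
      apply h2
      have : r • φ 1 = 0 := by
        rw [← map_smul]
        have : r • (1 : kk R) = 0 := by
          change Ideal.Quotient.mk _ (r * 1) = 0
          rw [Ideal.Quotient.eq_zero_iff_mem, mul_one]
          exact hr
        rw [this, map_zero]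
      exact congrArg Subtype.val this
    obtain ⟨u, rfl⟩ := hr
    have := f.range.smul_mem (↑u⁻¹ : R) h1
    rwa [← mul_smul, Units.inv_mul, one_smul] at this
  let T : (kk R →ₗ[R] E) →ₗ[R] f.range := 
    { toFun := fun φ => ⟨φ 1, key φ⟩
      map_add' := fun _ _ => rfl
      map_smul' := fun _ _ => rfl }
  refine Module.Finite.of_injective T ?_
  intro φ ψ h
  ext
  exact congrArg (fun x : f.range => (x : I)) h
end II1
end LCHelp

namespace LCHelp
section JJ1
variable {R : Type u} [CommRing R] 

lemma smul_top_pi (I : Ideal R) (k : ℕ) (v : Fin k → R) : v ∈ I • (⊤ : Submodule R (Fin k → R)) ↔ ∀ i, v i ∈ I := by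
  constructor
  · intro h i
    induction h using Submodule.smul_induction_on' with
    | smul r hr n hn => exact I.mul_mem_right _ hr
    | add x _ y _ h1 h2 => exact I.add_mem h1 h2
  · intro h
    rw [pi_eq_sum_univ v]
    exact Submodule.sum_mem _ fun i _ => Submodule.smul_mem_smul (h i) trivial

lemma precomplete_pi (I : Ideal R) [IsAdicComplete I R] (k : ℕ) : IsPrecomplete I (Fin k → R) := by
  refine ⟨fun f hf => ?_⟩
  have h1 : ∀ i : Fin k, ∃ L : R, ∀ n, f n i ≡ L [SMOD (I ^ n • ⊤ : Submodule R R)] := by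
    intro i
    apply IsPrecomplete.prec'
    intro m n hmn
    have := hf hmn
    rw [SModEq.sub_mem, smul_top_pi] at this
    rw [SModEq.sub_mem]
    simpa using this i
  choose L hL using h1
  refine ⟨L, fun n => ?_⟩
  rw [SModEq.sub_mem, smul_top_pi]
  intro i
  have := hL i n
  rw [SModEq.sub_mem] at this
  simpa using this

variable {N M L : Type u} [AddCommGroup N] [Module R N] [AddCommGroup M] [Module R M] [AddCommGroup L] [Module R L]
variable (E : Type u) [AddCommGroup E] [Module R E] 

lemma hom_exact [Module.Injective R E] {f : N →ₗ[R] M} {g : M →ₗ[R] L} (h : Function.Exact f g) (φ : M →ₗ[R] E)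
    (hφ : φ ∘ₗ f = 0) : ∃ ψ : L →ₗ[R] E, ψ ∘ₗ g = φ := by
  have hker : g.ker ≤ φ.ker := by
    intro x hx
    obtain ⟨y, rfl⟩ := (h x).1 hx
    exact congrArg (fun t => t y) hφ
  obtain ⟨ψ, hψ⟩ := Module.Injective.out (Q := E) (g.ker.liftQ g le_rfl)
    (by rw [← LinearMap.ker_eq_bot]; exact Submodule.ker_liftQ_eq_bot _ _ _ le_rfl)
    (g.ker.liftQ φ hker)
  refine ⟨ψ, LinearMap.ext fun x => ?_⟩
  exact hψ (Submodule.Quotient.mk x)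

lemma Gam_exact [IsNoetherianRing R] (a : Ideal R) {f : N →ₗ[R] M} {g : M →ₗ[R] L} (h : Function.Exact f g) 
    (hN : ∀ n, n ∈ Gam a N) (x : M) (hx : g x ∈ Gam a L) : x ∈ Gam a M := by
  obtain ⟨t, ht⟩ := hx
  obtain ⟨s, hs⟩ := IsNoetherian.noetherian (a ^ t)
  have h1 : ∀ v : R, ∃ T : ℕ, v ∈ a ^ t → ∀ u ∈ a ^ T, u • v • x = 0 := by
    intro v
    by_cases hv : v ∈ a ^ t
    · have : g (v • x) = 0 := by rw [map_smul, ht v hv]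
      obtain ⟨n, hn⟩ := (h _).1 this
      obtain ⟨T, hT⟩ := hN n
      exact ⟨T, fun _ u hu => by rw [← hn, ← map_smul, hT u hu, map_zero]⟩
    · exact ⟨0, fun h => absurd h hv⟩
  choose T hT using h1
  have h2 : ∀ v ∈ a ^ t, ∀ u ∈ a ^ (s.sup T), u • v • x = 0 := by
    intro v hv
    rw [← hs] at hv
    induction hv using Submodule.span_induction with
    | mem v hv => 
      intro u hu
      refine hT v ?_ u (Ideal.pow_le_pow_right (Finset.le_sup (f := T) hv) hu)
      rw [← hs]; exact Submodule.subset_span hv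
    | zero => simp
    | add v w _ _ h1 h2 => intro u hu; rw [add_smul, smul_add, h1 u hu, h2 u hu, add_zero]
    | smul q v _ h => intro u hu; rw [smul_eq_mul, mul_smul, smul_comm, h u hu, smul_zero]
  refine ⟨s.sup T + t, fun r hr => ?_⟩
  rw [pow_add] at hr
  induction hr using Submodule.mul_induction_on' with
  | mem_mul_mem u hu v hv => rw [mul_smul]; exact h2 v hv u hu
  | add u _ v _ h1 h2 => rw [add_smul, h1, h2, add_zero]

variable [IsLocalRing R] 

/-- Matlis dual finite and m-torsion. -/
def QQ (R : Type u) [CommRing R] [IsLocalRing R] (E : Type u) [AddCommGroup E] [Module R E] (M : Type u) [AddCommGroup M] [Module R M] : Prop := (∀ h : M, h ∈ Gam (IsLocalRing.maximalIdeal R) M) ∧ Module.Finite R (M →ₗ[R] E)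

variable {E}
lemma QQ_exact [IsNoetherianRing R] [Module.Injective R E] {f : N →ₗ[R] M} {g : M →ₗ[R] L} (h : Function.Exact f g) 
    (hN : QQ R E N) (hL : QQ R E L) : QQ R E M := by
  obtain ⟨a1, a2⟩ := hN
  obtain ⟨b1, b2⟩ := hL
  refine ⟨fun x => Gam_exact _ h a1 x (b1 _), ?_⟩
  have : IsNoetherian R (M →ₗ[R] E) := by
    refine isNoetherian_of_range_eq_ker (g.lcomp R E) (f.lcomp R E) ?_
    ext φ
    constructor
    · rintro ⟨ψ, rfl⟩
      ext x
      change ψ (g (f x)) = 0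
      rw [h.apply_apply_eq_zero, map_zero]
    · intro hφ
      exact hom_exact E h φ hφ
  infer_instance

lemma QQ_sub [Subsingleton M] : QQ R E M := 
  ⟨fun h => ⟨0, fun _ _ => Subsingleton.elim _ _⟩, 
   have : Subsingleton (M →ₗ[R] E) := ⟨fun f g => LinearMap.ext fun x => by rw [Subsingleton.elim x 0, map_zero, map_zero]⟩
   inferInstance⟩

lemma QQ_inj [IsNoetherianRing R] [Module.Injective R E] {g : M →ₗ[R] L} (hg : Function.Injective g) 
    (hL : QQ R E L) : QQ R E M := 
  QQ_exact (f := (0 : PUnit.{u+1} →ₗ[R] M)) (g := g) 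
   (by rw [LinearMap.exact_iff, LinearMap.ker_eq_bot.2 hg, LinearMap.range_zero]) QQ_sub hL

lemma QQ_surj [IsNoetherianRing R] [Module.Injective R E] {f : N →ₗ[R] M} (hf : Function.Surjective f) 
    (hN : QQ R E N) : QQ R E M := 
  QQ_exact (f := f) (g := (0 : M →ₗ[R] PUnit.{u+1})) 
   (by rw [LinearMap.exact_iff, LinearMap.range_eq_top.2 hf, LinearMap.ker_zero]) hN QQ_sub 

lemma QQ_x [IsNoetherianRing R] [Module.Injective R E] [IsAdicComplete (IsLocalRing.maximalIdeal R) R] {x : R} (hx : x ∈ (IsLocalRing.maximalIdeal R))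
    (hM : ∀ m : M, ∃ t : ℕ, x ^ t • m = 0) (K : Submodule R M) (hK : K = (x • (LinearMap.id : M →ₗ[R] M)).ker)
    (hQ : QQ R E K) : QQ R E M := by
  have hex : Function.Exact K.subtype (x • (LinearMap.id : M →ₗ[R] M)) := by
    rw [LinearMap.exact_iff, ← hK, Submodule.range_subtype]
  have hG : ∀ h : M, h ∈ Gam (IsLocalRing.maximalIdeal R) M := by
    intro h
    obtain ⟨t, ht⟩ := hM h
    induction t generalizing h with
    | zero => 
      have : h = 0 := by simpa using ht
      rw [this]; exact zero_mem _
    | succ t ih =>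
      refine Gam_exact _ hex hQ.1 h (ih _ ?_)
      change x ^ t • x • h = 0
      rw [← mul_smul, ← pow_succ, ht]
  refine ⟨hG, ?_⟩
  have hH : IsHausdorff (IsLocalRing.maximalIdeal R) (M →ₗ[R] E) := by
    refine ⟨fun φ hφ => LinearMap.ext fun h => ?_⟩
    obtain ⟨t, ht⟩ := hG h
    have := hφ t
    rw [SModEq.zero] at this
    change φ h = 0
    clear hφ
    induction this using Submodule.smul_induction_on' with
    | smul r hr ψ _ => 
      change r • ψ h = 0
      rw [← map_smul, ht r hr, map_zero]
    | add u _ v _ h1 h2 => rw [LinearMap.add_apply, h1, h2, add_zero]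
  obtain ⟨_, hfin⟩ := hQ
  obtain ⟨k, F, hF⟩ := Module.Finite.exists_fin' R (K →ₗ[R] E)
  have hres : ∀ φ : K →ₗ[R] E, ∃ ψ : M →ₗ[R] E, ψ ∘ₗ K.subtype = φ := by
    intro φ
    obtain ⟨ψ, hψ⟩ := Module.Injective.out (Q := E) K.subtype K.injective_subtype φ
    exact ⟨ψ, LinearMap.ext hψ⟩
  choose lift hlift using fun i : Fin k => hres (F (Pi.single i 1))
  let F' : (Fin k → R) →ₗ[R] (M →ₗ[R] E) := Fintype.linearCombination R lift
  have hF' : ∀ v, F' v ∘ₗ K.subtype = F v := by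
    intro v
    have : (K.subtype.lcomp R E) ∘ₗ F' = F := by
      apply LinearMap.pi_ext'
      intro i
      ext1
      simp [F', LinearMap.lcomp]
      exact hlift i
    exact congrArg (fun t => t v) this
  have := precomplete_pi (IsLocalRing.maximalIdeal R) k
  refine Module.Finite.of_surjective F' (surjective_of_mkQ_comp_surjective (I := (IsLocalRing.maximalIdeal R)) ?_)
  intro d
  obtain ⟨d, rfl⟩ := Submodule.mkQ_surjective _ d
  obtain ⟨v, hv⟩ := hF (d ∘ₗ K.subtype)
  refine ⟨v, ?_⟩
  rw [LinearMap.comp_apply, eq_comm, ← sub_eq_zero, ← map_sub]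
  refine (Submodule.Quotient.mk_eq_zero _).2 ?_
  obtain ⟨ψ, hψ⟩ := hom_exact E hex (d - F' v) (by rw [LinearMap.sub_comp, hF', hv, sub_self])
  have : d - F' v = x • ψ := by
    rw [← hψ]; ext y; simp
  rw [this]
  exact Submodule.smul_mem_smul hx trivial
end JJ1
end LCHelp

namespace LCHelp
section KK1
variable {R : Type u} [CommRing R] [IsNoetherianRing R]

lemma min_prime {I q : Ideal R} (hq : q ∈ I.minimalPrimes) : ∃ s ∉ q, ∃ k : ℕ, ∀ r ∈ q ^ k, s * r ∈ I := by
  classical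
  have hqp : q.IsPrime := hq.1.1
  let S := (Ideal.finite_minimalPrimes_of_isNoetherianRing R I).toFinset.erase q
  have h1 : ¬ S.inf id ≤ q := by
    rw [hqp.inf_le']
    rintro ⟨q', h1, h2⟩
    have h1' := (Finset.mem_erase.1 h1)
    have h3 : q' ∈ I.minimalPrimes := by simpa using h1'.2
    exact h1'.1 (le_antisymm h2 (hq.2 h3.1 h2))
  obtain ⟨s, hs, hsq⟩ := Set.not_subset.1 h1
  have h2 : Ideal.span {s} * q ≤ I.radical := by
    rw [← Ideal.sInf_minimalPrimes, le_sInf_iff]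
    intro q' hq'
    by_cases h : q' = q
    · rw [h]; exact Ideal.mul_le_right
    · refine Ideal.mul_le_left.trans ?_
      rw [Ideal.span_singleton_le_iff_mem]
      have : S.inf id ≤ q' := Finset.inf_le (f := id) (by simp [S, h, hq'])
      exact this hs
  obtain ⟨k, hk⟩ := Ideal.exists_pow_le_of_le_radical_of_fg h2 (IsNoetherian.noetherian _)
  refine ⟨s ^ k, fun h => hsq (hqp.mem_of_pow_mem _ h), k, fun r hr => hk ?_⟩
  rw [mul_pow]
  exact Ideal.mul_mem_mul (Ideal.pow_mem_pow (Ideal.mem_span_singleton_self s) k) hr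

lemma H_sub (a : Ideal R) (i : ℕ) (N : Type u) [AddCommGroup N] [Module R N] [Subsingleton N] : Subsingleton (H a i N) := by
  refine subsingleton_of_forall_eq 0 fun x => ?_
  have h1 : (LinearMap.id : N →ₗ[R] N) = (0 : R) • LinearMap.id := LinearMap.ext fun x => Subsingleton.elim _ _
  have h2 := Hm_id (M := N) a i
  rw [h1, Hm_smul_id, zero_smul] at h2
  exact (congrArg (fun f => f x) h2).symm

lemma H_top (i : ℕ) (N : Type u) [AddCommGroup N] [Module R N] : Subsingleton (H (⊤ : Ideal R) i N) := by
  refine subsingleton_of_forall_eq 0 fun x => ?_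
  obtain ⟨t, ht⟩ := H_tors ⊤ i N x
  simpa using ht 1 (by simp [Ideal.top_pow])

variable [IsLocalRing R] {E : Type u} [AddCommGroup E] [Module R E] [Module.Injective R E]

lemma QQ_dev (a : Ideal R) (i : ℕ) (M : Type u) [AddCommGroup M] [Module R M] [Module.Finite R M]
    (h : ∀ p ∈ Module.support R M, QQ R E (H a i (R ⧸ p.asIdeal))) : QQ R E (H a i M) := by
  refine devissage (R := R) (fun N _ _ => QQ R E (H a i N)) ?_ ?_ ?_ M h
  · intro N N' _ _ _ _ e h
    exact QQ_surj (f := (He a i e).toLinearMap) (He a i e).surjective h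
  · intro N _ _ _
    have := H_sub a i N
    exact QQ_sub
  · intro N₁ N₂ N₃ _ _ _ _ _ _ f g hf hg hfg h1 h3
    exact QQ_exact (LES2 a hf hg hfg i) h1 h3

lemma QQ_prime [IsAdicComplete (IsLocalRing.maximalIdeal R) R] (hE : Module.Finite R (kk R →ₗ[R] E)) (a : Ideal R) (i : ℕ) :
    ∀ p : PrimeSpectrum R, Order.coheight p ≤ (i : ℕ∞) → QQ R E (H a i (R ⧸ p.asIdeal)) := by
  induction i with
  | zero => 
    intro p hp
    have hp : IsMax p := by simpa [Order.coheight_eq_zero] using hp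
    have : p.asIdeal = IsLocalRing.maximalIdeal R := by
      have h := hp (b := IsLocalRing.closedPoint R) (IsLocalRing.le_maximalIdeal p.2.ne_top)
      exact le_antisymm (IsLocalRing.le_maximalIdeal p.2.ne_top) h
    rw [this]
    exact QQ_inj (ε_inj a) ⟨R_tors le_rfl, hE⟩
  | succ i ih =>
    intro p hp
    by_cases hap : a ≤ p.asIdeal
    · have := H_acyc a i _ (R_tors hap)
      exact QQ_sub
    by_cases hat : a = ⊤
    · subst hat
      have := H_top (R := R) (i+1) (R ⧸ p.asIdeal)
      exact QQ_sub
    obtain ⟨x, hxa, hxp⟩ := Set.not_subset.1 hap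
    have hL : QQ R E (H a i ((R ⧸ p.asIdeal) ⧸ (mulx p.asIdeal x).range)) := by
      apply QQ_dev
      intro q hq
      apply ih
      obtain ⟨h1, h2⟩ := supp_mulx _ _ _ hq
      exact coh_lt h1 hxp h2 hp
    obtain ⟨d, h1, h2⟩ := LES a (mulx_inj p.asIdeal hxp) (Submodule.mkQ_surjective _) (LinearMap.exact_map_mkQ_range _) i
    refine QQ_x (IsLocalRing.le_maximalIdeal hat hxa) ?_ _ rfl ?_
    · intro m
      obtain ⟨t, ht⟩ := H_tors a (i+1) _ m
      exact ⟨t, ht _ (Ideal.pow_mem_pow hxa t)⟩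
    · rw [Hm_smul_id] at h2
      rw [LinearMap.exact_iff.1 h2]
      exact QQ_surj (f := d.rangeRestrict) (LinearMap.surjective_rangeRestrict d) hL

lemma dual_zero {j : kk R →ₗ[R] E} (hj : Function.Injective j) (N : Type u) [AddCommGroup N] [Module R N] 
    (h : ∀ φ : N →ₗ[R] E, φ = 0) : Subsingleton N := by
  refine subsingleton_of_forall_eq 0 fun x => ?_
  by_contra hx
  -- cyclic module maps onto k
  let T : R →ₗ[R] N := LinearMap.toSpanSingleton R N x
  have hker : T.ker ≤ IsLocalRing.maximalIdeal R := by
    refine IsLocalRing.le_maximalIdeal fun h => hx ?_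
    have : (1 : R) ∈ T.ker := by rw [h]; trivial
    simpa [T] using this
  obtain ⟨ψ, hψ⟩ := Module.Injective.out (Q := E) (T.ker.liftQ T le_rfl)
    (by rw [← LinearMap.ker_eq_bot]; exact Submodule.ker_liftQ_eq_bot _ _ _ le_rfl)
    (j ∘ₗ T.ker.liftQ (Submodule.mkQ (IsLocalRing.maximalIdeal R)) (by simpa using hker))
  have h1 := hψ (Submodule.Quotient.mk 1)
  rw [h ψ] at h1
  have h2 : j (Submodule.Quotient.mk 1) = 0 := h1.symm
  have h3 : (Submodule.Quotient.mk 1 : kk R) = 0 := hj (by rw [h2, map_zero])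
  rw [Submodule.Quotient.mk_eq_zero] at h3
  exact (Ideal.ne_top_iff_one _).1 (IsLocalRing.maximalIdeal.isMaximal R).ne_top h3
end KK1
end LCHelp

namespace LCHelp
section LL1
variable {R : Type u} [CommRing R]

/-- if x θ = s on a finite module D then some r0, a power of s modulo x, kills D. -/
lemma alg_kill {D : Type u} [AddCommGroup D] [Module R D] [Module.Finite R D] (θ : D →ₗ[R] D) (x s : R)
    (h : ∀ d, x • θ d = s • d) (q : Ideal R) [q.IsPrime] (hx : x ∈ q) (hs : s ∉ q) : ∃ r0 ∉ q, ∀ d : D, r0 • d = 0 := by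
  obtain ⟨g, hg, h0⟩ := LinearMap.exists_monic_and_aeval_eq_zero R θ
  have h1 := Polynomial.scaleRoots_aeval_eq_zero (r := x) h0
  have h2 : algebraMap R (Module.End R D) x * θ = algebraMap R (Module.End R D) s := by
    ext d
    exact h d
  rw [h2, Polynomial.aeval_algebraMap_apply] at h1
  refine ⟨_, ?_, fun d => congrArg (fun t => t d) h1⟩
  rw [← Ideal.Quotient.eq_zero_iff_mem, Polynomial.coe_aeval_eq_eval, ← Polynomial.eval_map_apply,
    Polynomial.map_scaleRoots _ _ _ (by rw [hg.leadingCoeff, map_one]; exact one_ne_zero),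
    Ideal.Quotient.eq_zero_iff_mem.2 hx, Polynomial.scaleRoots_zero, (hg.map _).leadingCoeff, one_smul,
    Polynomial.eval_pow, Polynomial.eval_X]
  exact pow_ne_zero _ (fun h => hs (Ideal.Quotient.eq_zero_iff_mem.1 h))

variable [IsNoetherianRing R] [IsLocalRing R] {E : Type u} [AddCommGroup E] [Module R E] [Module.Injective R E]

lemma max_eq {p : PrimeSpectrum R} (hp : Order.coheight p ≤ ((0 : ℕ) : ℕ∞)) : p.asIdeal = IsLocalRing.maximalIdeal R := by
  have hp : IsMax p := by simpa [Order.coheight_eq_zero] using hp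
  have h := hp (b := IsLocalRing.closedPoint R) (IsLocalRing.le_maximalIdeal p.2.ne_top)
  exact le_antisymm (IsLocalRing.le_maximalIdeal p.2.ne_top) h

lemma HLVT_step [IsAdicComplete (IsLocalRing.maximalIdeal R) R] (hE : Module.Finite R (kk R →ₗ[R] E)) 
    {j : kk R →ₗ[R] E} (hj : Function.Injective j) (a : Ideal R) (n : ℕ) (p q : PrimeSpectrum R) 
    (hp : Order.coheight p ≤ ((n+1 : ℕ) : ℕ∞)) (x : R) (hxp : x ∉ p.asIdeal)
    (hq : q.asIdeal ∈ (p.asIdeal ⊔ Ideal.span {x}).minimalPrimes)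
    (hvan : ∀ (L : Type u) [AddCommGroup L] [Module R L] [Module.Finite R L], 
      (∀ r ∈ Module.support R L, q.asIdeal ≤ r.asIdeal) → Subsingleton (H a n L)) :
    Subsingleton (H a (n+1) (R ⧸ p.asIdeal)) := by
  have hpq : p.asIdeal ≤ q.asIdeal := le_sup_left.trans hq.1.2
  have hxq : x ∈ q.asIdeal := hq.1.2 (Ideal.mem_sup_right (Ideal.mem_span_singleton_self x))
  have hcq : Order.coheight q ≤ (n : ℕ∞) := coh_lt hpq hxp hxq hp
  obtain ⟨s, hsq, k, hk⟩ := min_prime hq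
  let J : Submodule R (R ⧸ p.asIdeal) := (mulx p.asIdeal x).range.comap (mulx p.asIdeal s)
  have hsupp : ∀ r ∈ Module.support R ((R ⧸ p.asIdeal) ⧸ J), q.asIdeal ≤ r.asIdeal := by
    intro r hr
    rw [Module.mem_support_iff_of_finite] at hr
    refine Ideal.IsPrime.le_of_pow_le (n := k) (I := q.asIdeal) fun u hu => hr ?_
    rw [Module.mem_annihilator]
    intro m
    obtain ⟨m, rfl⟩ := Submodule.mkQ_surjective _ m
    obtain ⟨m, rfl⟩ := Ideal.Quotient.mk_surjective m
    rw [← map_smul]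
    refine (Submodule.Quotient.mk_eq_zero _).2 ?_
    obtain ⟨y, hy, z, hz, hyz⟩ := Submodule.mem_sup.1 (hk u hu)
    obtain ⟨w, rfl⟩ := Ideal.mem_span_singleton'.1 hz
    refine ⟨Ideal.Quotient.mk _ (w * m), ?_⟩
    change Ideal.Quotient.mk _ (x * (w * m)) = Ideal.Quotient.mk _ (s * (u * m))
    rw [eq_comm, Ideal.Quotient.eq]
    have : s * (u * m) - x * (w * m) = y * m := by linear_combination (-m) * hyz
    rw [this]
    exact Ideal.mul_mem_right _ _ hy
  have v1 : Subsingleton (H a n ((R ⧸ p.asIdeal) ⧸ J)) := hvan _ hsupp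
  have v2 : Subsingleton (H a (n+1) ((R ⧸ p.asIdeal) ⧸ J)) := by
    apply Groth
    intro r hr
    have : q ≤ r := hsupp r hr
    refine lt_of_le_of_lt ((Order.coheight_anti this).trans hcq) ?_
    exact_mod_cast Nat.lt_succ_self n
  have hex : Function.Exact J.subtype J.mkQ := by
    rw [LinearMap.exact_iff, Submodule.ker_mkQ, Submodule.range_subtype]
  obtain ⟨d, h1, h2⟩ := LES a J.injective_subtype J.mkQ_surjective hex n
  have h3 := LES2 a J.injective_subtype J.mkQ_surjective hex (n+1)
  have hbij : Function.Bijective (Hm a (n+1) J.subtype) := by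
    constructor
    · rw [← LinearMap.ker_eq_bot, LinearMap.ker_eq_bot']
      intro m hm
      obtain ⟨y, rfl⟩ := (h2 m).1 hm
      rw [Subsingleton.elim y 0, map_zero]
    · intro y
      exact (h3 y).1 (Subsingleton.elim _ _)
  let e := LinearEquiv.ofInjective (mulx p.asIdeal x) (mulx_inj _ hxp)
  let ψ : J →ₗ[R] (R ⧸ p.asIdeal) := e.symm.toLinearMap ∘ₗ 
    ((mulx p.asIdeal s) ∘ₗ J.subtype).codRestrict (mulx p.asIdeal x).range (fun y => y.2)
  have hψ : x • ψ = s • J.subtype := by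
    ext y
    have : (e (ψ y) : R ⧸ p.asIdeal) = s • (y : R ⧸ p.asIdeal) := by
      simp [ψ]
      rfl
    exact this
  let eH := LinearEquiv.ofBijective _ hbij
  let θ : H a (n+1) (R ⧸ p.asIdeal) →ₗ[R] H a (n+1) (R ⧸ p.asIdeal) := Hm a (n+1) ψ ∘ₗ eH.symm.toLinearMap
  have hθ : ∀ h, x • θ h = s • h := by
    intro h
    have h4 := congrArg (fun f => Hm a (n+1) f (eH.symm h)) hψ
    simp only [Hm_smul] at h4
    have h5 : Hm a (n+1) J.subtype (eH.symm h) = h := eH.apply_symm_apply h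
    rw [LinearMap.smul_apply, LinearMap.smul_apply, h5] at h4
    exact h4
  obtain ⟨-, hfin⟩ := QQ_prime hE a (n+1) p hp
  obtain ⟨r0, hr0, hkill⟩ := alg_kill (θ.lcomp R E) x s (fun φ => by
    ext h
    change x • φ (θ h) = s • φ h
    rw [← map_smul, hθ, map_smul]) q.asIdeal hxq hsq
  have hr0p : r0 ∉ p.asIdeal := fun h => hr0 (hpq h)
  have hsurj : ∀ h : H a (n+1) (R ⧸ p.asIdeal), ∃ y, r0 • y = h := by
    have v3 : Subsingleton (H a (n+1) ((R ⧸ p.asIdeal) ⧸ (mulx p.asIdeal r0).range)) := by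
      apply Groth
      intro r hr
      obtain ⟨h1, h2⟩ := supp_mulx _ _ _ hr
      refine lt_of_le_of_lt (coh_lt h1 hr0p h2 hp) ?_
      exact_mod_cast Nat.lt_succ_self n
    intro h
    have h6 := LES2 a (mulx_inj p.asIdeal hr0p) (Submodule.mkQ_surjective _) (LinearMap.exact_map_mkQ_range _) (n+1)
    obtain ⟨y, hy⟩ := (h6 h).1 (Subsingleton.elim _ _)
    rw [Hm_smul_id] at hy
    exact ⟨y, hy⟩
  refine dual_zero hj _ fun φ => LinearMap.ext fun h => ?_
  obtain ⟨y, rfl⟩ := hsurj h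
  rw [map_smul, ← LinearMap.smul_apply, hkill]
  rfl

lemma HLVT [IsAdicComplete (IsLocalRing.maximalIdeal R) R] (hE : Module.Finite R (kk R →ₗ[R] E)) 
    {j : kk R →ₗ[R] E} (hj : Function.Injective j) (a : Ideal R) (P : PrimeSpectrum R) (haP : a ≤ P.asIdeal)
    (hP : P.asIdeal ≠ IsLocalRing.maximalIdeal R) (n : ℕ) : 
    ∀ p : PrimeSpectrum R, p.asIdeal ≤ P.asIdeal → Order.coheight p ≤ ((n+1 : ℕ) : ℕ∞) → 
      Subsingleton (H a (n+1) (R ⧸ p.asIdeal)) := by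
  induction n with
  | zero => 
    intro p hpP hp
    by_cases hap : a ≤ p.asIdeal
    · exact H_acyc a _ _ (R_tors hap)
    obtain ⟨x, hxa, hxp⟩ := Set.not_subset.1 hap
    exact absurd (max_eq (coh_lt hpP hxp (haP hxa) hp)) hP
  | succ n ih =>
    intro p hpP hp
    by_cases hap : a ≤ p.asIdeal
    · exact H_acyc a _ _ (R_tors hap)
    obtain ⟨x, hxa, hxp⟩ := Set.not_subset.1 hap
    have hle : p.asIdeal ⊔ Ideal.span {x} ≤ P.asIdeal := 
      sup_le hpP ((Ideal.span_singleton_le_iff_mem _).2 (haP hxa))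
    obtain ⟨q, hq, hqP⟩ := Ideal.exists_minimalPrimes_le hle
    let q' : PrimeSpectrum R := ⟨q, hq.1.1⟩
    have hcq : Order.coheight q' ≤ ((n+1 : ℕ) : ℕ∞) := 
      coh_lt (le_sup_left.trans hq.1.2) hxp (hq.1.2 (Ideal.mem_sup_right (Ideal.mem_span_singleton_self x))) hp
    refine HLVT_step hE hj a (n+1) p q' hp x hxp hq ?_
    intro L _ _ _ hL
    apply H_van_dev
    intro r hr
    have hqr : q' ≤ r := hL r hr
    rcases hqr.eq_or_lt with h | h
    · rw [← h]; exact ih q' hqP hcq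
    · apply Groth_prime
      have := (Order.coheight_add_one_le h).trans hcq
      exact (ENat.add_one_le_iff (ne_of_lt (lt_of_le_of_lt (le_self_add.trans this) (ENat.natCast_lt_top _)))).1 this
end LL1
end LCHelp

namespace LCHelp
section MM1
variable {R : Type u} [CommRing R]

lemma coh_le_dim (A : Ideal R) (n : ℕ) (hdim : ringKrullDim (R ⧸ A) = (n : WithBot (WithTop ℕ))) (r : PrimeSpectrum R) 
    (hr : A ≤ r.asIdeal) : Order.coheight r ≤ (n : ℕ∞) := by
  rw [ringKrullDim_quotient] at hdim
  have h1 : Order.krullDim (Set.Ici r) ≤ Order.krullDim (PrimeSpectrum.zeroLocus (R := R) A) := by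
    refine Order.krullDim_le_of_strictMono (fun x => ⟨x.1, ?_⟩) ?_
    · exact hr.trans (show r ≤ x.1 from x.2)
    · intro x y h; exact h
  rw [hdim, ← Order.coheight_eq_krullDim_Ici] at h1
  exact WithBot.coe_le_coe.1 h1

lemma coh_lt_dim (A : Ideal R) (n : ℕ) (hdim : ringKrullDim (R ⧸ A) = (n : WithBot (WithTop ℕ))) (r : PrimeSpectrum R) 
    (hr : A ≤ r.asIdeal) : Order.coheight r < (n : ℕ∞) ∨ r.asIdeal ∈ A.minimalPrimes := by
  obtain ⟨q, hq, hqr⟩ := Ideal.exists_minimalPrimes_le hr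
  by_cases h : q = r.asIdeal
  · right; rwa [← h]
  left
  have hlt : (⟨q, hq.1.1⟩ : PrimeSpectrum R) < r := lt_of_le_of_ne hqr (fun e => h (congrArg PrimeSpectrum.asIdeal e))
  have := (Order.coheight_add_one_le hlt).trans (coh_le_dim A n hdim ⟨q, hq.1.1⟩ hq.1.2)
  exact (ENat.add_one_le_iff (ne_of_lt (lt_of_le_of_lt (le_self_add.trans this) (ENat.natCast_lt_top _)))).1 this

variable [IsNoetherianRing R] [IsLocalRing R] 

lemma dim_le_one (b : Ideal R) (hb : ∀ r : PrimeSpectrum R, b ≤ r.asIdeal → r.asIdeal ≠ IsLocalRing.maximalIdeal R → 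
    ∀ t : PrimeSpectrum R, r ≤ t → t.asIdeal ≠ IsLocalRing.maximalIdeal R → t = r) : 
    ringKrullDim (R ⧸ b) ≤ (1 : WithBot (WithTop ℕ)) := by
  rw [ringKrullDim_quotient]
  refine Order.krullDim_le_one_iff.2 fun x => ?_
  by_cases hx : x.1.asIdeal = IsLocalRing.maximalIdeal R
  · right
    intro y _
    exact (IsLocalRing.le_maximalIdeal y.1.2.ne_top).trans hx.ge
  · left
    intro y hy
    have hyx : y.1 ≤ x.1 := hy
    have : y.1.asIdeal ≠ IsLocalRing.maximalIdeal R := by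
      intro h
      apply hx
      refine le_antisymm (IsLocalRing.le_maximalIdeal x.1.2.ne_top) ?_
      rw [← h]; exact hyx
    exact (hb y.1 y.2 this x.1 hyx hx).le

theorem main_thm [IsAdicComplete (IsLocalRing.maximalIdeal R) R] 
    (M : Type u) [AddCommGroup M] [Module R M] [Module.Finite R M]
    (n : ℕ) (hn : 1 ≤ n)
    (hdim : ringKrullDim (R ⧸ Module.annihilator R M) = (n : WithBot (WithTop ℕ)))
    (a : Ideal R) (hnz : Nontrivial (H a n M)) :
    ∃ b : Ideal R, ringKrullDim (R ⧸ b) ≤ (1 : WithBot (WithTop ℕ)) ∧ Nonempty (H a n M ≃ₗ[R] H b n M) := by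
  classical
  obtain ⟨E, _, _, _, j, hj, hE⟩ := exE R
  have hat : a ≠ ⊤ := by
    rintro rfl
    exact not_nontrivial_iff_subsingleton.2 (H_top n M) hnz
  obtain ⟨n, rfl⟩ : ∃ k, n = k + 1 := ⟨n - 1, by omega⟩
  set A := Module.annihilator R M with hA
  let S := (Ideal.finite_minimalPrimes_of_isNoetherianRing R A).toFinset
  have hS : ∀ q, q ∈ S ↔ q ∈ A.minimalPrimes := fun q => by simp [S]
  let X : Ideal R → Ideal R → Prop := fun q I => I.IsPrime ∧ I ≠ IsLocalRing.maximalIdeal R ∧ a ⊔ q ≤ I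
  have hX : ∀ q, ∃ P, (∃ I, X q I) → Maximal (X q) P := by
    intro q
    by_cases h : ∃ I, X q I
    · obtain ⟨P, hP⟩ := exists_maximal_of_wellFoundedGT (X q) h
      exact ⟨P, fun _ => hP⟩
    · exact ⟨⊤, fun h' => absurd h' h⟩
  choose Pf hPf using hX
  let b : Ideal R := IsLocalRing.maximalIdeal R ⊓ (S.filter (fun q => ∃ I, X q I)).inf Pf
  have hbP : ∀ q ∈ S, (∃ I, X q I) → b ≤ Pf q := fun q hq h => 
    inf_le_right.trans (Finset.inf_le (Finset.mem_filter.2 ⟨hq, h⟩))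
  have haP : ∀ q ∈ S, (∃ I, X q I) → a ≤ Pf q := fun q _ h => le_sup_left.trans (hPf q h).prop.2.2
  have hab : a ≤ b := by
    refine le_inf (IsLocalRing.le_maximalIdeal hat) (Finset.le_inf fun q hq => ?_)
    exact haP q (Finset.mem_filter.1 hq).1 (Finset.mem_filter.1 hq).2
  refine ⟨b, ?_, ?_⟩
  · apply dim_le_one
    intro r hr hrm t hrt htm
    rw [r.2.inf_le, r.2.inf_le'] at hr
    rcases hr with hr | ⟨q, hq, hr⟩
    · exact absurd (le_antisymm (IsLocalRing.le_maximalIdeal r.2.ne_top) hr) hrm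
    · have hmax := hPf q (Finset.mem_filter.1 hq).2
      have h1 : t.asIdeal ≤ Pf q := hmax.2 ⟨t.2, htm, hmax.prop.2.2.trans (hr.trans hrt)⟩ (hr.trans hrt)
      exact le_antisymm (h1.trans hr) hrt
  let c : Ideal R := (S.filter (fun q => ¬ ∃ I, X q I)).inf id
  have hmin : ∀ q, ∃ (s : R) (k : ℕ), q ∈ S → s ∉ q ∧ ∀ r ∈ q ^ k, s * r ∈ A := by
    intro q
    by_cases h : q ∈ S
    · obtain ⟨s, h1, k, h2⟩ := min_prime ((hS q).1 h)
      exact ⟨s, k, fun _ => ⟨h1, h2⟩⟩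
    · exact ⟨0, 0, fun h' => absurd h' h⟩
  choose s k hsk using hmin
  let K := S.sup k
  let N : Submodule R M := c ^ K • ⊤
  have hAN : ∀ r ∈ Module.support R N, A ≤ r.asIdeal := by
    intro r hr
    rw [Module.mem_support_iff_of_finite] at hr
    refine le_trans (fun u hu => ?_) hr
    rw [Module.mem_annihilator]
    intro m
    exact Subtype.ext (Module.mem_annihilator.1 hu m)
  have hsN : ∀ q ∈ S, (¬ ∃ I, X q I) → s q ∈ Module.annihilator R N := by
    intro q hq h
    rw [Module.mem_annihilator]
    rintro ⟨m, hm⟩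
    apply Subtype.ext
    change s q • m = 0
    induction hm using Submodule.smul_induction_on' with
    | smul r hr m _ =>
      rw [← mul_smul]
      refine Module.mem_annihilator.1 ((hsk q hq).2 r ?_) m
      have hcq : c ≤ q := Finset.inf_le (f := id) (Finset.mem_filter.2 ⟨hq, h⟩)
      exact Ideal.pow_le_pow_right (Finset.le_sup (f := k) hq) (Ideal.pow_right_mono hcq _ hr)
    | add u _ v _ h1 h2 => rw [smul_add, h1, h2, add_zero]
  have hvan1 : ∀ d : Ideal R, (∀ q ∈ S, (∃ I, X q I) → d ≤ Pf q) → Subsingleton (H d (n+1) N) := by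
    intro d hd
    apply H_van_dev
    intro r hr
    rcases coh_lt_dim A (n+1) hdim r (hAN r hr) with h | h
    · exact Groth_prime d _ r h
    · have hrS := (hS _).2 h
      by_cases hb : ∃ I, X r.asIdeal I
      · have hp := (hPf _ hb).prop
        exact HLVT hE hj d ⟨Pf r.asIdeal, hp.1⟩ (hd _ hrS hb) hp.2.1 n r (le_sup_right.trans hp.2.2) 
          (coh_le_dim A (n+1) hdim r (hAN r hr))
      · rw [Module.mem_support_iff_of_finite] at hr
        exact absurd (hr (hsN _ hrS hb)) (hsk _ hrS).1
  have hvan2 : ∀ d : Ideal R, Subsingleton (H d (n+1+1) N) := by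
    intro d
    apply Groth
    intro r hr
    refine lt_of_le_of_lt (coh_le_dim A (n+1) hdim r (hAN r hr)) ?_
    exact_mod_cast Nat.lt_succ_self (n+1)
  have hMN : ∀ d : Ideal R, (∀ q ∈ S, (∃ I, X q I) → d ≤ Pf q) → Nonempty (H d (n+1) M ≃ₗ[R] H d (n+1) (M ⧸ N)) := by
    intro d hd
    have := hvan1 d hd
    have := hvan2 d
    have hex : Function.Exact N.subtype N.mkQ := by
      rw [LinearMap.exact_iff, Submodule.ker_mkQ, Submodule.range_subtype]
    obtain ⟨δ, h1, h2⟩ := LES d N.injective_subtype N.mkQ_surjective hex (n+1)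
    exact exact_bij (LES2 d N.injective_subtype N.mkQ_surjective hex (n+1)) h1
  have htor : ∀ m : M ⧸ N, m ∈ Gam (c ^ K) (M ⧸ N) := by
    intro m
    refine ⟨1, fun r hr => ?_⟩
    obtain ⟨m, rfl⟩ := N.mkQ_surjective m
    rw [← map_smul]
    refine (Submodule.Quotient.mk_eq_zero _).2 ?_
    exact Submodule.smul_mem_smul (by simpa using hr) trivial
  have hrad : (a ⊔ c ^ K).radical = (b ⊔ c ^ K).radical := by
    refine le_antisymm (Ideal.radical_mono (sup_le_sup_right hab _)) ?_
    rw [Ideal.radical_le_radical_iff]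
    refine sup_le (inf_le_left.trans ?_) (le_sup_right.trans Ideal.le_radical)
    rw [Ideal.radical_eq_sInf]
    refine le_sInf ?_
    rintro P ⟨hP, hPp⟩
    have h1 : c ≤ P := Ideal.IsPrime.le_of_pow_le (le_sup_right.trans hP)
    rw [hPp.inf_le'] at h1
    obtain ⟨q, hq, hqP⟩ := h1
    by_contra hne
    refine (Finset.mem_filter.1 hq).2 ⟨P, hPp, fun h => hne h.ge, sup_le (le_sup_left.trans hP) hqP⟩
  obtain ⟨e1⟩ := hMN a haP
  obtain ⟨e2⟩ := C2 a (c ^ K) (n+1) _ htor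
  obtain ⟨e3⟩ := sameRad hrad (n+1) (M ⧸ N)
  obtain ⟨e4⟩ := C2 b (c ^ K) (n+1) _ htor
  obtain ⟨e5⟩ := hMN b hbP
  exact ⟨e1.trans (e2.trans (e3.trans (e4.symm.trans e5.symm)))⟩
end MM1
end LCHelp

theorem stmt3 (R : Type u) [CommRing R] [IsNoetherianRing R] [IsLocalRing R]
    [IsAdicComplete (IsLocalRing.maximalIdeal R) R]
    (M : Type u) [AddCommGroup M] [Module R M] [Module.Finite R M]
    (n : ℕ) (hn : 1 ≤ n)
    (hdim : ringKrullDim (R ⧸ Module.annihilator R M) = (n : WithBot (WithTop ℕ)))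
    (a : Ideal R)
    (hnz : Nontrivial ((localCohomology a n).obj (ModuleCat.of R M))) :
    ∃ b : Ideal R, ringKrullDim (R ⧸ b) ≤ (1 : WithBot (WithTop ℕ)) ∧
      Nonempty (((localCohomology a n).obj (ModuleCat.of R M)) ≃ₗ[R]
        ((localCohomology b n).obj (ModuleCat.of R M))) := by
  exact LCHelp.main_thm M n hn hdim a hnz

end
end

section
/- Let (R, m) be a complete Noetherian local ring and M a finite R-module of Krull dimension 1. Then for every subset T of Assh_R(M) there exists an ideal a of R such that Att_R(H^1_a(M)) = T. -/
/-!
STATEMENT 4 (Dibaei–Jafari, Corollary 2.3): if `(R, m)` is a complete Noetherian local ring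
and `M` a finite `R`-module of dimension `1`, then every subset `T` of `Assh_R(M)` equals
`Att_R(H^1_a(M))` for some ideal `a`.
-/

open CategoryTheory

noncomputable section

universe u

section Helpers

open Opposite

section LinAlg
variable {R : Type u} [CommRing R] {M : Type u} [AddCommGroup M] [Module R M]

/-- start of a resolution of `R/(x^t)` -/
structure Res (x : R) (t : ℕ) {P0 P1 P2 : Type u} [AddCommGroup P0] [AddCommGroup P1]
    [AddCommGroup P2] [Module R P0] [Module R P1] [Module R P2]
    (d2 : P2 →ₗ[R] P1) (d1 : P1 →ₗ[R] P0) (π : P0 →ₗ[R] R ⧸ (Ideal.span {x}) ^ t) : Prop where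
  ex1 : ∀ y, d1 y = 0 → ∃ e, d2 e = y
  ex0 : ∀ p, π p = 0 → ∃ y, d1 y = p
  z1 : ∀ e, d1 (d2 e) = 0
  z0 : ∀ e, π (d1 e) = 0
  surj : Function.Surjective π
  pr0 : Module.Projective R P0
  pr1 : Module.Projective R P1

variable {x : R} {t : ℕ} {P0 P1 P2 : Type u} [AddCommGroup P0] [AddCommGroup P1]
    [AddCommGroup P2] [Module R P0] [Module R P1] [Module R P2]
    {d2 : P2 →ₗ[R] P1} {d1 : P1 →ₗ[R] P0} {π : P0 →ₗ[R] R ⧸ (Ideal.span {x}) ^ t}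

lemma Res.exists_ab (H : Res x t d2 d1 π) :
    ∃ ab : P0 × P1, π ab.1 = Ideal.Quotient.mk _ 1 ∧ d1 ab.2 = x ^ t • ab.1 := by
  obtain ⟨a, ha⟩ := H.surj (Ideal.Quotient.mk _ 1)
  obtain ⟨b, hb⟩ := H.ex0 (x ^ t • a) (by
    rw [map_smul, ha, ← Ideal.Quotient.mk_eq_mk, ← Submodule.Quotient.mk_smul,
      Submodule.Quotient.mk_eq_zero, Ideal.span_singleton_pow]
    exact Ideal.mem_span_singleton.2 (by simp))
  exact ⟨(a, b), ha, hb⟩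

lemma Res.exists_u (H : Res x t d2 d1 π) :
    ∃ (u0 : P0 →ₗ[R] R) (u1 : P1 →ₗ[R] R), (∀ p, Ideal.Quotient.mk _ (u0 p) = π p) ∧
      ∀ y, u0 (d1 y) = x ^ t * u1 y := by
  have := H.pr0
  have := H.pr1
  obtain ⟨u0, h0⟩ := Module.projective_lifting_property
    (Submodule.mkQ ((Ideal.span {x}) ^ t)) π (Submodule.mkQ_surjective _)
  let θ : R →ₗ[R] R := LinearMap.mulLeft R (x ^ t)
  have hmem : ∀ y, (u0 ∘ₗ d1) y ∈ LinearMap.range θ := by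
    intro y
    have h1 : Submodule.mkQ ((Ideal.span {x}) ^ t) (u0 (d1 y)) = 0 := by
      have := LinearMap.congr_fun h0 (d1 y)
      rw [H.z0] at this
      exact this
    rw [Submodule.mkQ_apply, Submodule.Quotient.mk_eq_zero, Ideal.span_singleton_pow,
      Ideal.mem_span_singleton] at h1
    obtain ⟨c, hc⟩ := h1
    exact ⟨c, hc.symm⟩
  obtain ⟨u1, h1⟩ := Module.projective_lifting_property θ.rangeRestrict
    ((u0 ∘ₗ d1).codRestrict _ hmem) θ.surjective_rangeRestrict
  refine ⟨u0, u1, fun p => LinearMap.congr_fun h0 p, fun y => ?_⟩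
  exact (congrArg Subtype.val (LinearMap.congr_fun h1 y)).symm

lemma Res.exists_cob (H : Res x t d2 d1 π) {a : P0} {b : P1} (ha : π a = Ideal.Quotient.mk _ 1)
    (hb : d1 b = x ^ t • a) (f : P1 →ₗ[R] M) (hf : f ∘ₗ d2 = 0) (m : M) (hm : f b = x ^ t • m) :
    ∃ g : P0 →ₗ[R] M, f = g ∘ₗ d1 := by
  obtain ⟨u0, u1, hu0, hu1⟩ := H.exists_u
  have := H.pr0
  let k : P0 →ₗ[R] P0 := LinearMap.id - (LinearMap.toSpanSingleton R P0 a) ∘ₗ u0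
  have hk : ∀ p, k p = p - u0 p • a := fun p => rfl
  have hmem : ∀ p, k p ∈ LinearMap.range d1 := by
    intro p
    obtain ⟨y, hy⟩ := H.ex0 (k p) (by
      rw [hk, map_sub, map_smul, ha, ← hu0, ← Ideal.Quotient.mk_eq_mk, ← Ideal.Quotient.mk_eq_mk,
        ← Submodule.Quotient.mk_smul]
      simp)
    exact ⟨y, hy⟩
  obtain ⟨w, hw⟩ := Module.projective_lifting_property d1.rangeRestrict
    (k.codRestrict _ hmem) d1.surjective_rangeRestrict
  have hw' : ∀ p, d1 (w p) = p - u0 p • a := fun p =>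
    congrArg Subtype.val (LinearMap.congr_fun hw p)
  refine ⟨(LinearMap.toSpanSingleton R M m) ∘ₗ u0 + f ∘ₗ w, ?_⟩
  ext y
  have h1 : d1 (w (d1 y) - (y - u1 y • b)) = 0 := by
    rw [map_sub, hw', map_sub, map_smul, hb, hu1, smul_smul, mul_comm]
    simp
  obtain ⟨e, he⟩ := H.ex1 _ h1
  have h2 : f (w (d1 y) - (y - u1 y • b)) = 0 := by
    rw [← he]; exact LinearMap.congr_fun hf e
  rw [map_sub, sub_eq_zero, map_sub, map_smul, hm] at h2
  simp only [LinearMap.comp_apply, LinearMap.add_apply, LinearMap.toSpanSingleton_apply]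
  rw [h2, hu1, smul_smul, mul_comm]
  simp

lemma Res.nat {k : ℕ} {P0' P1' P2' : Type u} [AddCommGroup P0'] [AddCommGroup P1']
    [AddCommGroup P2'] [Module R P0'] [Module R P1'] [Module R P2']
    {d1' : P1' →ₗ[R] P0'} {a' : P0'} {b' : P1'}
    (H : Res x t d2 d1 π) {a : P0} {b : P1} (ha : π a = Ideal.Quotient.mk _ 1)
    (hb : d1 b = x ^ t • a) (v0 : P0' →ₗ[R] P0) (v1 : P1' →ₗ[R] P1)
    (hv : ∀ y, v0 (d1' y) = d1 (v1 y)) (ha' : π (v0 a') = Ideal.Quotient.mk _ 1)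
    (hb' : d1' b' = x ^ (t + k) • a') (f : P1 →ₗ[R] M) (hf : f ∘ₗ d2 = 0) :
    ∃ c, f (v1 b') = x ^ k • f b + x ^ (t + k) • f c := by
  obtain ⟨c, hc⟩ := H.ex0 (v0 a' - a) (by rw [map_sub, ha, ha', sub_self])
  have h1 : d1 (v1 b' - (x ^ k • b + x ^ (t + k) • c)) = 0 := by
    rw [map_sub, ← hv, hb', map_add, map_smul, map_smul, map_smul, hb, hc, smul_smul, ← pow_add,
      add_comm k t, smul_sub]
    abel
  obtain ⟨e, he⟩ := H.ex1 _ h1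
  have h2 : f (v1 b' - (x ^ k • b + x ^ (t + k) • c)) = 0 := by
    rw [← he]; exact LinearMap.congr_fun hf e
  rw [map_sub, sub_eq_zero] at h2
  exact ⟨c, by rw [h2, map_add, map_smul, map_smul]⟩

/-- `M_x / M` -/
abbrev Cx (x : R) (M : Type u) [AddCommGroup M] [Module R M] : Type u :=
  LocalizedModule (Submonoid.powers x) M ⧸
    LinearMap.range (LocalizedModule.mkLinearMap (Submonoid.powers x) M)

/-- the power as an element -/
def pw (x : R) (t : ℕ) : Submonoid.powers x := ⟨x ^ t, t, rfl⟩

/-- `m ↦ m / x^t` -/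
def frac (x : R) (M : Type u) [AddCommGroup M] [Module R M] (t : ℕ) : M →ₗ[R] Cx x M :=
  Submodule.mkQ _ ∘ₗ LocalizedModule.divBy (pw x t) ∘ₗ
    LocalizedModule.mkLinearMap (Submonoid.powers x) M

lemma frac_apply (t : ℕ) (m : M) :
    frac x M t m = Submodule.Quotient.mk (LocalizedModule.mk m (pw x t)) := by
  simp [frac, LocalizedModule.liftOn_mk]

lemma frac_self (t : ℕ) (m : M) : frac x M t (x ^ t • m) = 0 := by
  rw [frac_apply, Submodule.Quotient.mk_eq_zero]
  exact ⟨m, by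
    rw [LocalizedModule.mkLinearMap_apply, LocalizedModule.mk_eq]
    exact ⟨1, by simp [pw, Submonoid.smul_def]⟩⟩

lemma frac_add (t k : ℕ) (m : M) : frac x M (t + k) (x ^ k • m) = frac x M t m := by
  rw [frac_apply, frac_apply]
  congr 1
  rw [LocalizedModule.mk_eq]
  exact ⟨1, by simp [pw, Submonoid.smul_def, smul_smul, pow_add]⟩

lemma frac_zero (t : ℕ) (m : M) (h : frac x M t m = 0) :
    ∃ k m0, x ^ k • m = x ^ (t + k) • m0 := by
  rw [frac_apply, Submodule.Quotient.mk_eq_zero] at h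
  obtain ⟨m0, h⟩ := h
  rw [LocalizedModule.mkLinearMap_apply, LocalizedModule.mk_eq] at h
  obtain ⟨⟨_, k, rfl⟩, hu⟩ := h
  refine ⟨k, m0, ?_⟩
  simp only [pw, Submonoid.smul_def, smul_smul, one_smul] at hu
  rw [← hu, pow_add, mul_comm]

lemma frac_surj (c : Cx x M) : ∃ t m, frac x M t m = c := by
  obtain ⟨c, rfl⟩ := Submodule.Quotient.mk_surjective _ c
  induction c using LocalizedModule.induction_on with
  | h m s =>
    obtain ⟨_, k, rfl⟩ := s
    exact ⟨k, m, frac_apply _ _⟩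

lemma exists_stable [IsNoetherianRing R] (x : R) : ∃ s, ∀ k r, x ^ (s + k) * r = 0 → x ^ s * r = 0 := by
  let F : ℕ →o Submodule R R := ⟨fun n => LinearMap.ker (LinearMap.mulLeft R (x ^ n)), by
    intro i j hij r hr
    obtain ⟨k, rfl⟩ := Nat.exists_eq_add_of_le hij
    simp only [LinearMap.mem_ker, LinearMap.mulLeft_apply] at hr ⊢
    rw [pow_add, mul_comm (x ^ i), mul_assoc, hr, mul_zero]⟩
  obtain ⟨s, hs⟩ := monotone_stabilizes_iff_noetherian.2 (inferInstance : IsNoetherian R R) F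
  refine ⟨s, fun k r h => ?_⟩
  have : r ∈ F s := by
    rw [hs (s + k) (by omega)]
    exact h
  exact this

lemma Res.exists_cocycle {s : ℕ} (hs : ∀ k r, x ^ (s + k) * r = 0 → x ^ s * r = 0)
    {π : P0 →ₗ[R] R ⧸ (Ideal.span {x}) ^ (t + s)}
    (H : Res x (t + s) d2 d1 π) {a : P0} {b : P1} (ha : π a = Ideal.Quotient.mk _ 1)
    (hb : d1 b = x ^ (t + s) • a) (m : M) :
    ∃ f : P1 →ₗ[R] M, f ∘ₗ d2 = 0 ∧ frac x M (t + s) (f b) = frac x M t m := by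
  obtain ⟨u0, u1, hu0, hu1⟩ := H.exists_u
  refine ⟨LinearMap.toSpanSingleton R M (x ^ s • m) ∘ₗ u1, ?_, ?_⟩
  · ext e
    have h1 := hu1 (d2 e)
    rw [H.z1, map_zero] at h1
    have h2 := hs t (u1 (d2 e)) (by rw [add_comm, ← h1])
    simp only [LinearMap.comp_apply, LinearMap.toSpanSingleton_apply, LinearMap.zero_apply]
    rw [smul_smul, mul_comm, h2, zero_smul]
  · have h1 := hu1 b
    rw [hb, map_smul, smul_eq_mul] at h1
    have h2 := hs t (u0 a - u1 b) (by rw [add_comm, mul_sub, h1, sub_self])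
    have h3 : Ideal.Quotient.mk ((Ideal.span {x}) ^ (t + s)) (u0 a) = Ideal.Quotient.mk _ 1 := by
      rw [hu0, ha]
    rw [Ideal.Quotient.eq, Ideal.span_singleton_pow, Ideal.mem_span_singleton] at h3
    obtain ⟨c, hc⟩ := h3
    have h4 : u1 b • x ^ s • m = x ^ s • m + x ^ (t + s) • c • x ^ s • m := by
      simp only [smul_smul, ← add_smul]
      congr 1
      linear_combination x ^ s * hc - h2
    simp only [LinearMap.comp_apply, LinearMap.toSpanSingleton_apply]
    rw [h4, map_add, frac_self, frac_add, add_zero]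

end LinAlg

section ExtStuff
variable {R : Type u} [CommRing R]

def yonMap {K L : ChainComplex (ModuleCat.{u} R) ℕ} (φ : K ⟶ L) (Y : ModuleCat.{u} R) :
    L.linearYonedaObj R Y ⟶ K.linearYonedaObj R Y :=
  (HomologicalComplex.unopFunctor _ _).map
    ((((linearYoneda R (ModuleCat.{u} R)).obj Y).rightOp.mapHomologicalComplex _).map φ).op

lemma yonMap_f_apply {K L : ChainComplex (ModuleCat.{u} R) ℕ} (φ : K ⟶ L) (Y : ModuleCat.{u} R)
    (i : ℕ) (f : L.X i ⟶ Y) :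
    ((yonMap φ Y).f i).hom f = φ.f i ≫ f := rfl

lemma yon_d_apply {K : ChainComplex (ModuleCat.{u} R) ℕ} (Y : ModuleCat.{u} R)
    (i j : ℕ) (f : K.X i ⟶ Y) :
    ((K.linearYonedaObj R Y).d i j).hom f = K.d j i ≫ f := rfl

lemma gen_unop {C : Type*} [Category* C] {A A' : Cᵒᵖ} {B B' : C} (H : A' ⟶ A) (e : A ≅ op B)
    (e' : A' ≅ op B') (m : B ⟶ B') (h : H ≫ e.hom = e'.hom ≫ m.op) :
    H.unop ≫ e'.inv.unop = e.inv.unop ≫ m := by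
  rw [← Quiver.Hom.unop_op m, ← unop_comp, ← unop_comp]
  congr 1
  rw [Iso.inv_comp_eq, ← Category.assoc, ← h, Category.assoc, Iso.hom_inv_id, Category.comp_id]

lemma isoExt_nat {X X' Y : ModuleCat.{u} R} (φ : X' ⟶ X) (P : ProjectiveResolution X)
    (P' : ProjectiveResolution X') (v : P'.complex ⟶ P.complex)
    (hv : v.f 0 ≫ P.π.f 0 = P'.π.f 0 ≫ φ) (n : ℕ) :
    ((Ext R (ModuleCat.{u} R) n).map φ.op).app Y ≫ (P'.isoExt n Y).hom =
      (P.isoExt n Y).hom ≫ HomologicalComplex.homologyMap (yonMap v Y) n := by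
  have h1 := ProjectiveResolution.isoLeftDerivedObj_inv_naturality φ P' P v hv
    ((linearYoneda R (ModuleCat.{u} R)).obj Y).rightOp n
  have h2 := HomologicalComplex.homologyOp_hom_naturality (yonMap v Y) n
  have h1' := congrArg Quiver.Hom.unop h1
  have h2' := congrArg Quiver.Hom.unop h2
  set KP := P.complex.linearYonedaObj R Y
  set KP' := P'.complex.linearYonedaObj R Y
  have h3 : (HomologicalComplex.homologyMap ((HomologicalComplex.opFunctor _ _).map (yonMap v Y).op) n).unop ≫ (KP'.homologyOp n).inv.unop
      = (KP.homologyOp n).inv.unop ≫ HomologicalComplex.homologyMap (yonMap v Y) n := gen_unop _ _ _ _ h2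
  change ((((linearYoneda R (ModuleCat.{u} R)).obj Y).rightOp.leftDerived n).map φ).unop ≫ (P'.isoLeftDerivedObj ((linearYoneda R (ModuleCat.{u} R)).obj Y).rightOp n).inv.unop ≫ (KP'.homologyOp n).inv.unop = ((P.isoLeftDerivedObj ((linearYoneda R (ModuleCat.{u} R)).obj Y).rightOp n).inv.unop ≫ (KP.homologyOp n).inv.unop) ≫ _
  refine (Category.assoc _ _ _).symm.trans ?_
  refine (congrArg (· ≫ (KP'.homologyOp n).inv.unop) h1').trans ?_
  refine (Category.assoc _ _ _).trans ((congrArg (fun z => (P.isoLeftDerivedObj ((linearYoneda R (ModuleCat.{u} R)).obj Y).rightOp n).inv.unop ≫ z) h3).trans (Category.assoc _ _ _).symm)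



section
variable {X X' : ModuleCat.{u} R} (P : ProjectiveResolution X) (P' : ProjectiveResolution X')
  (Y : ModuleCat.{u} R)

/-- Ext^1 -/
abbrev E1 (X Y : ModuleCat.{u} R) : ModuleCat.{u} R :=
  ((Ext R (ModuleCat.{u} R) 1).obj (op X)).obj Y

/-- cocycles -/
abbrev Zc : ModuleCat.{u} R := (P.complex.linearYonedaObj R Y).cycles 1

/-- class of a cocycle -/
def cl : Zc P Y →ₗ[R] E1 X Y :=
  ((P.complex.linearYonedaObj R Y).homologyπ 1 ≫ (P.isoExt 1 Y).inv).hom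

/-- underlying map of a cocycle -/
def ic : Zc P Y →ₗ[R] (P.complex.X 1 →ₗ[R] Y) where
  toFun z := ModuleCat.Hom.hom (((P.complex.linearYonedaObj R Y).iCycles 1).hom z : P.complex.X 1 ⟶ Y)
  map_add' a b := by rw [map_add]; rfl
  map_smul' a b := by rw [map_smul]; rfl

lemma cl_surj : Function.Surjective (cl P Y) := by
  have : Epi ((P.complex.linearYonedaObj R Y).homologyπ 1 ≫ (P.isoExt 1 Y).inv) := epi_comp _ _
  exact (ModuleCat.epi_iff_surjective _).1 this

lemma ic_inj : Function.Injective (ic P Y) := by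
  have : Mono ((P.complex.linearYonedaObj R Y).iCycles 1) := inferInstance
  have h := (ModuleCat.mono_iff_injective _).1 this
  intro a b hab
  apply h
  exact ModuleCat.hom_ext hab

lemma ic_d (z : Zc P Y) : ic P Y z ∘ₗ (P.complex.d 2 1).hom = 0 := by
  have := (P.complex.linearYonedaObj R Y).iCycles_d 1 2
  have h := congrArg (fun f => f.hom z) this
  exact congrArg ModuleCat.Hom.hom h

lemma gen_lift (K : CochainComplex (ModuleCat.{u} R) ℕ) (x : K.X 1) (hx : (K.d 1 2).hom x = 0) :
    ∃ z, (K.iCycles 1).hom z = x := by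
  let k : ModuleCat.of R R ⟶ K.X 1 := ModuleCat.ofHom (LinearMap.toSpanSingleton R _ x)
  have hk : k ≫ K.d 1 2 = 0 := by
    ext
    simp [k, hx]
  refine ⟨(K.liftCycles k 2 (by simp) hk).hom (1:R), ?_⟩
  have h1 := K.liftCycles_i k 2 (by simp) hk
  have h2 := congrArg (fun f => f.hom (1:R)) h1
  refine h2.trans ?_
  simp [k]

lemma ic_lift (f : P.complex.X 1 →ₗ[R] Y) (hf : f ∘ₗ (P.complex.d 2 1).hom = 0) :
    ∃ z, ic P Y z = f := by
  have h0 : ((P.complex.linearYonedaObj R Y).d 1 2).hom (ModuleCat.ofHom f : P.complex.X 1 ⟶ Y) = 0 :=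
    ModuleCat.hom_ext hf
  obtain ⟨z, hz⟩ := gen_lift (P.complex.linearYonedaObj R Y) _ h0
  exact ⟨z, congrArg ModuleCat.Hom.hom hz⟩

lemma cl_zero_of (z : Zc P Y) (g : P.complex.X 0 →ₗ[R] Y)
    (h : ic P Y z = g ∘ₗ (P.complex.d 1 0).hom) : cl P Y z = 0 := by
  have hz : z = ((P.complex.linearYonedaObj R Y).toCycles 0 1).hom
      (ModuleCat.ofHom g : P.complex.X 0 ⟶ Y) := by
    apply ic_inj
    rw [h]
    have := (P.complex.linearYonedaObj R Y).toCycles_i 0 1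
    have h := congrArg (fun f => f.hom (ModuleCat.ofHom g : P.complex.X 0 ⟶ Y)) this
    exact (congrArg ModuleCat.Hom.hom h).symm
  have h2 := (P.complex.linearYonedaObj R Y).toCycles_comp_homologyπ 0 1
  have h3 := congrArg (fun f => f.hom (ModuleCat.ofHom g : P.complex.X 0 ⟶ Y)) h2
  rw [hz]
  change (P.isoExt 1 Y).inv.hom _ = 0
  refine (congrArg (P.isoExt 1 Y).inv.hom h3).trans ?_
  exact map_zero (P.isoExt 1 Y).inv.hom

lemma of_cl_zero (z : Zc P Y) (h : cl P Y z = 0) :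
    ∃ g : P.complex.X 0 →ₗ[R] Y, ic P Y z = g ∘ₗ (P.complex.d 1 0).hom := by
  have h1 : ((P.complex.linearYonedaObj R Y).homologyπ 1).hom z = 0 := by
    have := (ModuleCat.mono_iff_injective (P.isoExt (R := R) 1 Y).inv).1 inferInstance
    apply this
    exact h.trans (map_zero (P.isoExt (R := R) 1 Y).inv.hom).symm
  have hc := (P.complex.linearYonedaObj R Y).homologyIsCokernel 0 1 (by simp)
  have hex : (ShortComplex.mk _ _
      ((P.complex.linearYonedaObj R Y).toCycles_comp_homologyπ 0 1)).Exact :=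
    ShortComplex.exact_of_g_is_cokernel _ hc
  obtain ⟨g, hg⟩ := (ShortComplex.moduleCat_exact_iff _).1 hex z h1
  refine ⟨(ModuleCat.Hom.hom (g : P.complex.X 0 ⟶ Y)), ?_⟩
  have := (P.complex.linearYonedaObj R Y).toCycles_i 0 1
  have h := congrArg (fun f => f.hom g) this
  rw [← hg]
  exact (congrArg ModuleCat.Hom.hom h)

lemma cl_nat (φ : X' ⟶ X) (v : P'.complex ⟶ P.complex)
    (hv : v.f 0 ≫ P.π.f 0 = P'.π.f 0 ≫ φ) (z : Zc P Y) :
    ∃ z', ic P' Y z' = ic P Y z ∘ₗ (v.f 1).hom ∧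
      (((Ext R (ModuleCat.{u} R) 1).map φ.op).app Y).hom (cl P Y z) = cl P' Y z' := by
  refine ⟨(HomologicalComplex.cyclesMap (yonMap v Y) 1).hom z, ?_, ?_⟩
  · have := HomologicalComplex.cyclesMap_i (yonMap v Y) 1
    have h := congrArg (fun f => f.hom z) this
    exact congrArg ModuleCat.Hom.hom h
  · have h1 := isoExt_nat (Y := Y) φ P P' v hv 1
    have h2 : (P.isoExt 1 Y).inv ≫ ((Ext R (ModuleCat.{u} R) 1).map φ.op).app Y =
      HomologicalComplex.homologyMap (yonMap v Y) 1 ≫ (P'.isoExt 1 Y).inv := by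
      rw [Iso.inv_comp_eq, ← Category.assoc, ← h1, Category.assoc, Iso.hom_inv_id, Category.comp_id]
    have h3 := HomologicalComplex.homologyπ_naturality (yonMap v Y) 1
    have h4 : ((P.complex.linearYonedaObj R Y).homologyπ 1 ≫ (P.isoExt 1 Y).inv) ≫ ((Ext R (ModuleCat.{u} R) 1).map φ.op).app Y =
        HomologicalComplex.cyclesMap (yonMap v Y) 1 ≫ ((P'.complex.linearYonedaObj R Y).homologyπ 1 ≫ (P'.isoExt 1 Y).inv) := by
      rw [Category.assoc, h2, ← Category.assoc, h3, Category.assoc]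
    exact congrArg (fun f => f.hom z) h4

end
end ExtStuff


section Col
open Limits
variable {R : Type u} [CommRing R]

lemma res_of (x : R) (t : ℕ)
    (P : ProjectiveResolution (ModuleCat.of R (R ⧸ (Ideal.span {x}) ^ t))) :
    Res x t (P.complex.d 2 1).hom (P.complex.d 1 0).hom
      (ModuleCat.Hom.hom (P.π.f 0 : P.complex.X 0 ⟶ ModuleCat.of R (R ⧸ (Ideal.span {x}) ^ t))) where
  ex1 := fun y hy => (ShortComplex.moduleCat_exact_iff _).1 (P.exact_succ 0) y hy
  ex0 := fun y hy => (ShortComplex.moduleCat_exact_iff _).1 P.exact₀ y hy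
  z1 := fun e => congrArg (fun f => f.hom e) (P.complex.d_comp_d 2 1 0)
  z0 := fun e => congrArg (fun f => f.hom e) P.complex_d_comp_π_f_zero
  surj := (ModuleCat.epi_iff_surjective _).1 (inferInstance : Epi (P.π.f 0))
  pr0 := (IsProjective.iff_projective _).2 (P.projective 0)
  pr1 := (IsProjective.iff_projective _).2 (P.projective 1)

variable (x : R) (M : ModuleCat.{u} R)

lemma exists_phi (t : ℕ) :
    ∃ φ : E1 (ModuleCat.of R (R ⧸ (Ideal.span {x}) ^ t)) M →ₗ[R] Cx x M,
      ∀ (P : ProjectiveResolution (ModuleCat.of R (R ⧸ (Ideal.span {x}) ^ t)))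
        (a : P.complex.X 0) (b : P.complex.X 1) (_ : (P.π.f 0).hom a = Ideal.Quotient.mk ((Ideal.span {x}) ^ t) 1)
        (_ : (P.complex.d 1 0).hom b = x ^ t • a) (z : Zc P M),
        φ (cl P M z) = frac x M t (ic P M z b) := by
  let Q := projectiveResolution (ModuleCat.of R (R ⧸ (Ideal.span {x}) ^ t))
  obtain ⟨⟨a0, b0⟩, ha0, hb0⟩ := (res_of x t Q).exists_ab
  let ψ : Zc Q M →ₗ[R] Cx x M := frac x M t ∘ₗ LinearMap.applyₗ b0 ∘ₗ ic Q M
  have hker : LinearMap.ker (cl Q M) ≤ LinearMap.ker ψ := by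
    intro z hz
    obtain ⟨g, hg⟩ := of_cl_zero Q M z hz
    change frac x M t (ic Q M z b0) = 0
    rw [hg, LinearMap.comp_apply, hb0, map_smul, frac_self]
  let φ : E1 (ModuleCat.of R (R ⧸ (Ideal.span {x}) ^ t)) M →ₗ[R] Cx x M :=
    (LinearMap.ker (cl Q M)).liftQ ψ hker ∘ₗ
      ((cl Q M).quotKerEquivOfSurjective (cl_surj Q M)).symm.toLinearMap
  have hφ : ∀ z, φ (cl Q M z) = frac x M t (ic Q M z b0) := by
    intro z
    have : ((cl Q M).quotKerEquivOfSurjective (cl_surj Q M)).symm (cl Q M z) =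
        Submodule.Quotient.mk z := by
      rw [LinearEquiv.symm_apply_eq]; rfl
    change (LinearMap.ker (cl Q M)).liftQ ψ hker (((cl Q M).quotKerEquivOfSurjective (cl_surj Q M)).symm (cl Q M z)) = _
    rw [this]
    rfl
  refine ⟨φ, fun P a b ha hb z => ?_⟩
  obtain ⟨z', h1, h2⟩ := cl_nat P Q M (𝟙 _) (ProjectiveResolution.lift (𝟙 _) Q P)
    (ProjectiveResolution.lift_commutes_zero _ _ _) z
  have h3 : cl P M z = cl Q M z' := by
    rw [← h2]
    simp
  rw [h3, hφ, h1]
  obtain ⟨c, hc⟩ := (res_of x t P).nat (k := 0) (P2' := PUnit) ha hb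
    (d1' := (Q.complex.d 1 0).hom) (a' := a0) (b' := b0)
    ((ProjectiveResolution.lift (𝟙 _) Q P).f 0).hom
    ((ProjectiveResolution.lift (𝟙 _) Q P).f 1).hom
    (fun y => congrArg (fun f => f.hom y) ((ProjectiveResolution.lift (𝟙 _) Q P).comm 1 0).symm)
    ((congrArg (fun f => f.hom a0) (ProjectiveResolution.lift_commutes_zero (𝟙 _) Q P)).trans ha0)
    hb0 (ic P M z) (ic_d P M z)
  rw [LinearMap.comp_apply, hc, map_add, pow_zero, one_smul, add_zero, frac_self, add_zero]


/-- the comparison map -/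
def phi (t : ℕ) : E1 (ModuleCat.of R (R ⧸ (Ideal.span {x}) ^ t)) M →ₗ[R] Cx x M :=
  (exists_phi x M t).choose

lemma phi_cl (t : ℕ) (P : ProjectiveResolution (ModuleCat.of R (R ⧸ (Ideal.span {x}) ^ t)))
    (a : P.complex.X 0) (b : P.complex.X 1)
    (ha : (P.π.f 0).hom a = Ideal.Quotient.mk ((Ideal.span {x}) ^ t) 1)
    (hb : (P.complex.d 1 0).hom b = x ^ t • a) (z : Zc P M) :
    phi x M t (cl P M z) = frac x M t (ic P M z b) :=
  (exists_phi x M t).choose_spec P a b ha hb z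

lemma phi_surj [IsNoetherianRing R] (c : Cx x M) : ∃ t e, phi x M t e = c := by
  obtain ⟨s, hs⟩ := exists_stable x
  obtain ⟨t, m, rfl⟩ := frac_surj c
  let P := projectiveResolution (ModuleCat.of R (R ⧸ (Ideal.span {x}) ^ (t + s)))
  obtain ⟨⟨a, b⟩, ha, hb⟩ := (res_of x (t + s) P).exists_ab
  obtain ⟨f, hf, hfb⟩ := (res_of x (t + s) P).exists_cocycle hs ha hb m
  obtain ⟨z, rfl⟩ := ic_lift P M f hf
  exact ⟨t + s, cl P M z, (phi_cl x M _ P a b ha hb z).trans hfb⟩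

/-- transition map between quotients -/
def trn (t k : ℕ) : ModuleCat.of R (R ⧸ (Ideal.span {x}) ^ (t + k)) ⟶
    ModuleCat.of R (R ⧸ (Ideal.span {x}) ^ t) :=
  ModuleCat.ofHom <| Submodule.mapQ _ _ LinearMap.id (Ideal.pow_le_pow_right (by omega))

lemma trans_cl (t k : ℕ) (P : ProjectiveResolution (ModuleCat.of R (R ⧸ (Ideal.span {x}) ^ t)))
    (P' : ProjectiveResolution (ModuleCat.of R (R ⧸ (Ideal.span {x}) ^ (t + k))))
    (a : P.complex.X 0) (b : P.complex.X 1)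
    (ha : (P.π.f 0).hom a = Ideal.Quotient.mk ((Ideal.span {x}) ^ t) 1)
    (hb : (P.complex.d 1 0).hom b = x ^ t • a)
    (a' : P'.complex.X 0) (b' : P'.complex.X 1)
    (ha' : (P'.π.f 0).hom a' = Ideal.Quotient.mk ((Ideal.span {x}) ^ (t + k)) 1)
    (hb' : (P'.complex.d 1 0).hom b' = x ^ (t + k) • a')
    (z : Zc P M) :
    ∃ z' : Zc P' M, (((Ext R (ModuleCat.{u} R) 1).map (trn x t k).op).app M).hom (cl P M z) =
      cl P' M z' ∧ ∃ m, ic P' M z' b' = x ^ k • ic P M z b + x ^ (t + k) • m := by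
  obtain ⟨z', h1, h2⟩ := cl_nat P P' M (trn x t k) (ProjectiveResolution.lift (trn x t k) P' P)
    (ProjectiveResolution.lift_commutes_zero _ _ _) z
  refine ⟨z', h2, ?_⟩
  obtain ⟨c, hc⟩ := (res_of x t P).nat (k := k) (P2' := PUnit) ha hb
    (d1' := (P'.complex.d 1 0).hom) (a' := a') (b' := b')
    ((ProjectiveResolution.lift (trn x t k) P' P).f 0).hom
    ((ProjectiveResolution.lift (trn x t k) P' P).f 1).hom
    (fun y => congrArg (fun f => f.hom y) ((ProjectiveResolution.lift (trn x t k) P' P).comm 1 0).symm)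
    ((congrArg (fun f => f.hom a') (ProjectiveResolution.lift_commutes_zero (trn x t k) P' P)).trans
      (congrArg (trn x t k).hom ha'))
    hb' (ic P M z) (ic_d P M z)
  exact ⟨_, by rw [h1, LinearMap.comp_apply, hc]⟩

lemma phi_trans (t k : ℕ) (e : E1 (ModuleCat.of R (R ⧸ (Ideal.span {x}) ^ t)) M) :
    phi x M (t + k) ((((Ext R (ModuleCat.{u} R) 1).map (trn x t k).op).app M).hom e) =
      phi x M t e := by
  let P := projectiveResolution (ModuleCat.of R (R ⧸ (Ideal.span {x}) ^ t))
  let P' := projectiveResolution (ModuleCat.of R (R ⧸ (Ideal.span {x}) ^ (t + k)))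
  obtain ⟨⟨a, b⟩, ha, hb⟩ := (res_of x t P).exists_ab
  obtain ⟨⟨a', b'⟩, ha', hb'⟩ := (res_of x (t + k) P').exists_ab
  obtain ⟨z, rfl⟩ := cl_surj P M e
  obtain ⟨z', h1, m, h2⟩ := trans_cl x M t k P P' a b ha hb a' b' ha' hb' z
  rw [h1, phi_cl x M _ P' a' b' ha' hb', h2, phi_cl x M _ P a b ha hb, map_add, frac_self,
    frac_add, add_zero]

lemma phi_inj (t : ℕ) (e : E1 (ModuleCat.of R (R ⧸ (Ideal.span {x}) ^ t)) M)
    (he : phi x M t e = 0) :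
    ∃ k, (((Ext R (ModuleCat.{u} R) 1).map (trn x t k).op).app M).hom e = 0 := by
  let P := projectiveResolution (ModuleCat.of R (R ⧸ (Ideal.span {x}) ^ t))
  obtain ⟨⟨a, b⟩, ha, hb⟩ := (res_of x t P).exists_ab
  obtain ⟨z, rfl⟩ := cl_surj P M e
  rw [phi_cl x M _ P a b ha hb] at he
  obtain ⟨k, m0, hk⟩ := frac_zero _ _ he
  let P' := projectiveResolution (ModuleCat.of R (R ⧸ (Ideal.span {x}) ^ (t + k)))
  obtain ⟨⟨a', b'⟩, ha', hb'⟩ := (res_of x (t + k) P').exists_ab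
  obtain ⟨z', h1, m, h2⟩ := trans_cl x M t k P P' a b ha hb a' b' ha' hb' z
  refine ⟨k, ?_⟩
  rw [h1]
  rw [hk, ← smul_add] at h2
  obtain ⟨g, hg⟩ := (res_of x (t + k) P').exists_cob ha' hb' (ic P' M z') (ic_d P' M z') _ h2
  exact cl_zero_of P' M z' g hg

/-- the diagram -/
abbrev Fd : ℕᵒᵖᵒᵖ ⥤ ModuleCat.{u} R ⥤ ModuleCat.{u} R :=
  localCohomology.diagram (localCohomology.idealPowersDiagram (Ideal.span {x})) 1

/-- the cocone -/
def cc : Cocone (Fd x ⋙ (evaluation _ _).obj M) where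
  pt := ModuleCat.of R (Cx x M)
  ι :=
    { app := fun j => ModuleCat.ofHom (phi x M j.unop.unop)
      naturality := by
        rintro ⟨⟨t⟩⟩ ⟨⟨t'⟩⟩ w
        obtain ⟨k, rfl⟩ : ∃ k, t' = t + k := Nat.exists_eq_add_of_le w.unop.unop.down.down
        ext e
        exact phi_trans x M t k e }

lemma exists_bij [IsNoetherianRing R] :
    ∃ ψ : ((localCohomology (Ideal.span {x}) 1).obj M) →ₗ[R] Cx x M, Function.Bijective ψ := by
  have hF : HasColimit (Fd x) := localCohomology.hasColimitDiagram _ 1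
  let hc : IsColimit (((evaluation _ _).obj M).mapCocone (colimit.cocone (Fd x))) :=
    isColimitOfPreserves ((evaluation (ModuleCat.{u} R) (ModuleCat.{u} R)).obj M)
      (colimit.isColimit (Fd x))
  have hfac : ∀ j (e : ((Fd x).obj j).obj M), (hc.desc (cc x M)).hom
      ((((colimit.cocone (Fd x)).ι.app j).app M).hom e) = phi x M j.unop.unop e := by
    intro j e
    exact congrArg (fun f => f.hom e) (hc.fac (cc x M) j)
  refine ⟨(hc.desc (cc x M)).hom, ?_, ?_⟩
  · refine (injective_iff_map_eq_zero (hc.desc (cc x M)).hom).2 ?_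
    intro h hh
    have hpf : PreservesFilteredColimitsOfSize.{0, 0} (forget (ModuleCat.{u} R)) :=
      preservesFilteredColimitsOfSize_shrink.{0, u, 0, u} _
    have hpc : PreservesColimit (Fd x ⋙ (evaluation (ModuleCat.{u} R) (ModuleCat.{u} R)).obj M)
        (forget (ModuleCat.{u} R)) :=
      (hpf.preserves_filtered_colimits (ℕᵒᵖᵒᵖ)).preservesColimit
    obtain ⟨⟨⟨t⟩⟩, e, rfl⟩ := Concrete.isColimit_exists_rep _ hc h
    have h1 : phi x M t e = 0 := (hfac ⟨⟨t⟩⟩ e).symm.trans hh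
    obtain ⟨k, hk⟩ := phi_inj x M t e h1
    have w : (op (op t) : ℕᵒᵖᵒᵖ) ⟶ op (op (t + k)) := (homOfLE (by omega) : t ⟶ t + k).op.op
    have h2 := (((evaluation _ _).obj M).mapCocone (colimit.cocone (Fd x))).w w
    have h3 := congrArg (fun f => f.hom e) h2
    refine h3.symm.trans ?_
    refine (congrArg ((((evaluation _ _).obj M).mapCocone (colimit.cocone (Fd x))).ι.app (op (op (t + k)))).hom hk).trans ?_
    exact map_zero _
  · intro c
    obtain ⟨t, e, rfl⟩ := phi_surj x M c
    exact ⟨_, hfac ⟨⟨t⟩⟩ e⟩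

end Col

section AlgD
variable {R : Type u} [CommRing R]

lemma att_equiv {N N' : Type u} [AddCommGroup N] [Module R N] [AddCommGroup N'] [Module R N']
    (e : N ≃ₗ[R] N') : attachedPrimes R N ⊆ attachedPrimes R N' := by
  rintro p ⟨hp, K, hK⟩
  refine ⟨hp, K.map e.toLinearMap, ?_⟩
  rw [hK]
  exact LinearEquiv.annihilator_eq (Submodule.Quotient.equiv K _ e rfl)

lemma dim_chain1 {I p q : Ideal R} (hp : p.IsPrime) (hq : q.IsPrime) (hI : I ≤ p)
    (h1 : p < q) : (1 : WithBot ℕ∞) ≤ ringKrullDim (R ⧸ I) := by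
  rw [ringKrullDim_quotient]
  let a : PrimeSpectrum.zeroLocus (I : Set R) := ⟨⟨p, hp⟩, hI⟩
  let b : PrimeSpectrum.zeroLocus (I : Set R) := ⟨⟨q, hq⟩, hI.trans h1.le⟩
  have hab : a < b := h1
  have := Order.LTSeries.length_le_krullDim ((RelSeries.singleton _ a).snoc b hab)
  exact this

lemma dim_chain2 {I p q r : Ideal R} (hp : p.IsPrime) (hq : q.IsPrime) (hr : r.IsPrime)
    (hI : I ≤ p) (h1 : p < q) (h2 : q < r) :
    (2 : WithBot ℕ∞) ≤ ringKrullDim (R ⧸ I) := by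
  rw [ringKrullDim_quotient]
  let a : PrimeSpectrum.zeroLocus (I : Set R) := ⟨⟨p, hp⟩, hI⟩
  let b : PrimeSpectrum.zeroLocus (I : Set R) := ⟨⟨q, hq⟩, hI.trans h1.le⟩
  let c : PrimeSpectrum.zeroLocus (I : Set R) := ⟨⟨r, hr⟩, (hI.trans h1.le).trans h2.le⟩
  have hab : a < b := h1
  have hbc : b < c := h2
  have := Order.LTSeries.length_le_krullDim
    (((RelSeries.singleton _ a).snoc b hab).snoc c
      (lt_of_eq_of_lt (RelSeries.last_snoc (RelSeries.singleton _ a) b hab) hbc))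
  exact this

lemma not_two_le : ¬ (2 : WithBot ℕ∞) ≤ 1 := by
  intro h
  have h' : ((2 : ℕ) : WithBot ℕ∞) ≤ ((1 : ℕ) : WithBot ℕ∞) := h
  exact absurd (Nat.cast_le.1 h') (by norm_num)

lemma dim_max [IsLocalRing R] :
    ringKrullDim (R ⧸ IsLocalRing.maximalIdeal R) = 0 := by
  let _ := Ideal.Quotient.field (IsLocalRing.maximalIdeal R)
  exact ringKrullDim_eq_zero_of_field _

lemma assh_lt_max [IsLocalRing R] {p : Ideal R} [hp : p.IsPrime]
    (h : ringKrullDim (R ⧸ p) = (1 : WithBot ℕ∞)) : p < IsLocalRing.maximalIdeal R := by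
  refine lt_of_le_of_ne (IsLocalRing.le_maximalIdeal hp.ne_top) ?_
  rintro rfl
  rw [dim_max] at h
  exact zero_ne_one h

lemma exists_x [IsNoetherianRing R] [IsLocalRing R]
    (M : Type u) [AddCommGroup M] [Module R M] [Module.Finite R M]
    (T : Set (Ideal R)) (hT : T ⊆ assh R M 1) :
    ∃ x ∈ IsLocalRing.maximalIdeal R, (∀ p ∈ T, x ∉ p) ∧ ∀ p ∈ assh R M 1, p ∉ T → x ∈ p := by
  classical
  have hfin : (assh R M 1).Finite := (associatedPrimes.finite R M).subset (fun p hp => hp.1)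
  have hTf : T.Finite := hfin.subset hT
  have hSf : (assh R M 1 \ T).Finite := hfin.subset Set.sdiff_subset
  let J : Ideal R := IsLocalRing.maximalIdeal R ⊓ hSf.toFinset.inf id
  have hprime : ∀ p ∈ assh R M 1, p.IsPrime := fun p hp => IsAssociatedPrime.isPrime hp.1
  have hJ : ¬ ((J : Set R) ⊆ ⋃ p ∈ hTf.toFinset, (p : Set R)) := by
    intro hsub
    have := (Ideal.subset_union_prime (f := fun p : Ideal R => p) (s := hTf.toFinset) ⊥ ⊥
      (fun p hp _ _ => hprime p (hT (by simpa using hp)))).1 hsub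
    obtain ⟨p, hpT, hle⟩ := this
    have hpA := hT ((Set.Finite.mem_toFinset _).1 hpT)
    have hpp := hprime p hpA
    have hpm : p < IsLocalRing.maximalIdeal R := assh_lt_max (hpA.2.trans (Nat.cast_one (R := WithBot ℕ∞)))
    rcases (Ideal.IsPrime.inf_le hpp).1 hle with h | h
    · exact absurd h (not_le_of_gt hpm)
    · obtain ⟨q, hq, hqp⟩ := (Ideal.IsPrime.inf_le' hpp).1 h
      have hq' := (Set.Finite.mem_toFinset _).1 hq
      have hne : q ≠ p := fun e => hq'.2 (e ▸ (Set.Finite.mem_toFinset _).1 hpT)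
      have hc := dim_chain2 (hprime q hq'.1) hpp inferInstance le_rfl (lt_of_le_of_ne hqp hne) hpm
      exact not_two_le (hc.trans_eq (hq'.1.2.trans (Nat.cast_one (R := WithBot ℕ∞))))
  obtain ⟨x, hxJ, hx⟩ := Set.not_subset.1 hJ
  simp only [Set.mem_iUnion, not_exists, Set.Finite.mem_toFinset] at hx
  refine ⟨x, hxJ.1, fun p hp => hx p hp, fun p hp hpT => ?_⟩
  exact (Finset.inf_le (f := id) (hSf.mem_toFinset.2 ⟨hp, hpT⟩) : _ ≤ p) hxJ.2

variable {M : Type u} [AddCommGroup M] [Module R M]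

lemma att_sub [IsNoetherianRing R] [IsLocalRing R] [Module.Finite R M]
    (hdim : ringKrullDim (R ⧸ Module.annihilator R M) = (1 : WithBot ℕ∞))
    (x : R) (hx : x ∈ IsLocalRing.maximalIdeal R) {P : Ideal R}
    (hP : P ∈ attachedPrimes R (Cx x M)) : P ∈ assh R M 1 ∧ x ∉ P := by
  obtain ⟨hPp, K, hK⟩ := hP
  have hann : Module.annihilator R M ≤ P := by
    intro r hr
    rw [hK, Module.mem_annihilator]
    intro c
    obtain ⟨c, rfl⟩ := Submodule.Quotient.mk_surjective _ c
    obtain ⟨t, m, rfl⟩ := frac_surj c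
    rw [← Submodule.Quotient.mk_smul, ← map_smul, Module.mem_annihilator.1 hr m, map_zero]
    rfl
  have hxP : x ∉ P := by
    intro hxP
    apply hPp.ne_top
    rw [hK, Ideal.eq_top_iff_one, Module.mem_annihilator]
    intro c
    obtain ⟨c, rfl⟩ := Submodule.Quotient.mk_surjective _ c
    obtain ⟨t, m, rfl⟩ := frac_surj c
    rw [hK, Module.mem_annihilator] at hxP
    have h1 := hxP (Submodule.Quotient.mk (frac x M (t + 1) m))
    rw [← Submodule.Quotient.mk_smul, ← map_smul] at h1
    have h2 := frac_add (x := x) t 1 m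
    rw [pow_one] at h2
    rw [one_smul, ← h2]
    exact h1
  have hPm : P < IsLocalRing.maximalIdeal R :=
    lt_of_le_of_ne (IsLocalRing.le_maximalIdeal hPp.ne_top) (fun e => hxP (e ▸ hx))
  refine ⟨⟨?_, ?_⟩, hxP⟩
  · apply Module.associatedPrimes.minimalPrimes_annihilator_subset_associatedPrimes
    refine ⟨⟨hPp, hann⟩, ?_⟩
    rintro Q ⟨hQ, hQa⟩ hQP
    by_contra hne
    have hc := dim_chain2 hQ hPp inferInstance hQa (lt_of_le_not_ge hQP hne) hPm
    exact not_two_le (hc.trans_eq hdim)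
  · refine Eq.trans (le_antisymm ?_ ?_) (Nat.cast_one (R := WithBot ℕ∞)).symm
    · have := ringKrullDim_le_of_surjective (Ideal.Quotient.factor hann)
        (Ideal.Quotient.factor_surjective hann)
      exact this.trans_eq hdim
    · exact dim_chain1 hPp inferInstance le_rfl hPm

open scoped TensorProduct in
lemma exists_fun [Module.Finite R M] {p : Ideal R} [hp : p.IsPrime]
    (h : Module.annihilator R M ≤ p) :
    ∃ l : M →ₗ[R] p.ResidueField, ∃ m, l m ≠ 0 := by
  have hs : (⟨p, hp⟩ : PrimeSpectrum R) ∈ Module.support R M := by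
    rw [Module.support_eq_zeroLocus]; exact h
  have hn := (Module.mem_support_iff_nontrivial_residueField_tensorProduct _).1 hs
  change Nontrivial (TensorProduct R p.ResidueField M) at hn
  obtain ⟨v, hv⟩ := exists_ne (0 : TensorProduct R p.ResidueField M)
  obtain ⟨f, hf⟩ : ∃ f : Module.Dual p.ResidueField (TensorProduct R p.ResidueField M),
      f v ≠ 0 := by
    by_contra! hcon
    exact hv ((Module.forall_dual_apply_eq_zero_iff p.ResidueField v).1 hcon)
  refine ⟨f.restrictScalars R ∘ₗ TensorProduct.mk R p.ResidueField M 1, ?_⟩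
  by_contra! hcon
  apply hf
  induction v using TensorProduct.induction_on with
  | zero => exact map_zero f
  | add a b ha hb =>
    by_contra hne
    have h1 : f a = 0 := by
      by_contra h1
      exact h1 (ha (by rintro rfl; exact h1 (map_zero f)) h1)
    have h2 : f b = 0 := by
      by_contra h2
      exact h2 (hb (by rintro rfl; exact h2 (map_zero f)) h2)
    exact hne (by rw [map_add, h1, h2, add_zero])
  | tmul a m =>
    have h1 : f (1 ⊗ₜ[R] m) = 0 := hcon m
    have h2 : a ⊗ₜ[R] m = a • ((1 : p.ResidueField) ⊗ₜ[R] m) := by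
      rw [TensorProduct.smul_tmul', smul_eq_mul, mul_one]
    rw [h2, map_smul, h1, smul_zero]

lemma att_sup [IsNoetherianRing R] [IsLocalRing R] [Module.Finite R M]
    (x : R) (hx : x ∈ IsLocalRing.maximalIdeal R) {p : Ideal R} [hp : p.IsPrime]
    (hann : Module.annihilator R M ≤ p) (hxp : x ∉ p) :
    p ∈ attachedPrimes R (Cx x M) := by
  obtain ⟨l, m, hm⟩ := exists_fun hann
  have hun : ∀ s : Submonoid.powers x, IsUnit (algebraMap R (Module.End R p.ResidueField) s) := by
    rintro ⟨_, n, rfl⟩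
    have h0 : algebraMap R p.ResidueField (x ^ n) ≠ 0 := fun h0 =>
      hxp (hp.mem_of_pow_mem n (Ideal.algebraMap_residueField_eq_zero.1 h0))
    rw [Module.End.isUnit_iff]
    constructor
    · refine (injective_iff_map_eq_zero _).2 ?_
      intro a ha
      rw [Module.algebraMap_end_apply, Algebra.smul_def] at ha
      exact (mul_eq_zero.1 ha).resolve_left h0
    · intro b
      refine ⟨(algebraMap R p.ResidueField (x ^ n))⁻¹ * b, ?_⟩
      rw [Module.algebraMap_end_apply, Algebra.smul_def, mul_inv_cancel_left₀ h0]
  let L := LocalizedModule.lift (Submonoid.powers x) l hun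
  have hL : ∀ (n : ℕ) m, x ^ n • L (LocalizedModule.mk m (pw x n)) = l m := by
    intro n m
    exact ((Module.End.algebraMap_isUnit_inv_apply_eq_iff (h := hun (pw x n)) _ _ _).1 rfl).symm
  let K' : Submodule R (LocalizedModule (Submonoid.powers x) M) := (LinearMap.range l).comap L
  have hle : LinearMap.range (LocalizedModule.mkLinearMap (Submonoid.powers x) M) ≤ K' := by
    rintro _ ⟨m, rfl⟩
    exact ⟨m, (LinearMap.congr_fun (LocalizedModule.lift_comp (Submonoid.powers x) l hun) m).symm⟩
  refine ⟨hp, K'.map (Submodule.mkQ _), le_antisymm ?_ ?_⟩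
  · intro r hr
    rw [Module.mem_annihilator]
    intro c
    obtain ⟨c, rfl⟩ := Submodule.Quotient.mk_surjective _ c
    obtain ⟨w, rfl⟩ := Submodule.Quotient.mk_surjective _ c
    rw [← Submodule.Quotient.mk_smul, Submodule.Quotient.mk_eq_zero, ← Submodule.Quotient.mk_smul]
    refine ⟨r • w, ?_, rfl⟩
    change L (r • w) ∈ LinearMap.range l
    rw [map_smul, ← algebraMap_smul p.ResidueField r, Ideal.algebraMap_residueField_eq_zero.2 hr,
      zero_smul]
    exact zero_mem _
  · intro r hr
    by_contra hrp
    rw [Module.mem_annihilator] at hr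
    have hz : ∀ n, r • L (LocalizedModule.mk m (pw x n)) ∈ LinearMap.range l := by
      intro n
      have h1 := hr (Submodule.Quotient.mk (Submodule.Quotient.mk
        (LocalizedModule.mk m (pw x n))))
      rw [← Submodule.Quotient.mk_smul, Submodule.Quotient.mk_eq_zero,
        ← Submodule.Quotient.mk_smul] at h1
      obtain ⟨w, hw, hw2⟩ := h1
      have h2 := (Submodule.Quotient.eq _).1 hw2
      have h3 := hle h2
      have h4 : r • LocalizedModule.mk m (pw x n) ∈ K' := by
        have h5 := K'.sub_mem hw h3
        rwa [sub_sub_cancel] at h5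
      have h6 : L (r • LocalizedModule.mk m (pw x n)) ∈ LinearMap.range l := h4
      rwa [map_smul] at h6
    let y : ℕ → LinearMap.range l := fun n => ⟨_, hz n⟩
    have hstep : ∀ n, x • y (n + 1) = y n := by
      intro n
      apply Subtype.ext
      change x • r • L (LocalizedModule.mk m (pw x (n + 1))) = r • L (LocalizedModule.mk m (pw x n))
      rw [smul_comm]
      congr 1
      rw [← map_smul, LocalizedModule.smul'_mk]
      congr 1
      rw [LocalizedModule.mk_eq]
      exact ⟨1, by simp [pw, Submonoid.smul_def, smul_smul, pow_succ]⟩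
    have hy : ∀ n, (y n : p.ResidueField) ≠ 0 := by
      intro n h0
      have h0' : r • L (LocalizedModule.mk m (pw x n)) = 0 := h0
      have h1 : r • l m = 0 := by rw [← hL n m, smul_comm, h0', smul_zero]
      rw [Algebra.smul_def] at h1
      rcases mul_eq_zero.1 h1 with h | h
      · exact hrp (Ideal.algebraMap_residueField_eq_zero.1 h)
      · exact hm h
    let F : ℕ →o Submodule R (LinearMap.range l) :=
      ⟨fun n => Submodule.span R {y n}, monotone_nat_of_le_succ (fun n => by
        rw [Submodule.span_singleton_le_iff_mem, ← hstep n]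
        exact Submodule.smul_mem _ _ (Submodule.mem_span_singleton_self _))⟩
    obtain ⟨n, hn⟩ := monotone_stabilizes_iff_noetherian.2
      (inferInstance : IsNoetherian R (LinearMap.range l)) F
    have h1 : y (n + 1) ∈ Submodule.span R {y n} := by
      have h2 : F n = F (n + 1) := hn (n + 1) (by omega)
      change y (n + 1) ∈ F n
      rw [h2]
      exact Submodule.mem_span_singleton_self _
    obtain ⟨d, hd⟩ := Submodule.mem_span_singleton.1 h1
    have hd' : d • (y n : p.ResidueField) = y (n + 1) := congrArg Subtype.val hd
    have hs' : x • (y (n + 1) : p.ResidueField) = y n := congrArg Subtype.val (hstep n)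
    rw [Algebra.smul_def] at hd' hs'
    have h4 : algebraMap R p.ResidueField (1 - d * x) * (y (n + 1) : p.ResidueField) = 0 := by
      rw [map_sub, map_one, map_mul, sub_mul, one_mul, mul_assoc, hs', hd', sub_self]
    have h5 := Ideal.algebraMap_residueField_eq_zero.1 ((mul_eq_zero.1 h4).resolve_right (hy _))
    have h6 := IsLocalRing.le_maximalIdeal hp.ne_top h5
    have h7 : (1 : R) ∈ IsLocalRing.maximalIdeal R := by
      have := Ideal.add_mem _ h6 (Ideal.mul_mem_left _ d hx)
      rwa [sub_add_cancel] at this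
    exact (Ideal.ne_top_iff_one _).1 (Ideal.IsPrime.ne_top inferInstance) h7

end AlgD

end Helpers

theorem stmt4 (R : Type u) [CommRing R] [IsNoetherianRing R] [IsLocalRing R]
    [IsAdicComplete (IsLocalRing.maximalIdeal R) R]
    (M : Type u) [AddCommGroup M] [Module R M] [Module.Finite R M]
    (hdim : ringKrullDim (R ⧸ Module.annihilator R M) = (1 : WithBot (WithTop ℕ)))
    (T : Set (Ideal R)) (hT : T ⊆ assh R M 1) :
    ∃ a : Ideal R,
      attachedPrimes R ((localCohomology a 1).obj (ModuleCat.of R M)) = T := by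
  obtain ⟨x, hx, hxT, hxS⟩ := exists_x M T hT
  refine ⟨Ideal.span {x}, ?_⟩
  obtain ⟨ψ, hψ⟩ := exists_bij x (ModuleCat.of R M)
  let e := LinearEquiv.ofBijective ψ hψ
  apply Set.Subset.antisymm
  · intro P hP
    have hP' : P ∈ attachedPrimes R (Cx x M) := att_equiv e hP
    obtain ⟨h1, h2⟩ := att_sub hdim x hx hP'
    by_contra hPT
    exact h2 (hxS P h1 hPT)
  · intro p hpT
    have hpA := hT hpT
    have hpp : p.IsPrime := IsAssociatedPrime.isPrime hpA.1
    have hann : Module.annihilator R M ≤ p :=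
      le_of_eq_of_le Submodule.annihilator_top.symm (IsAssociatedPrime.annihilator_le hpA.1)
    exact att_equiv e.symm (att_sup (M := M) x hx hann (hxT p hpT))

end
end
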